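/- Let K be a totally complex number field of degree 6 that is Galois over ℚ, let α₁, …, α₅ ∈ K be ℚ-linearly independent elements such that the ratios αⱼ/α_k generate K over ℚ, and let m be a nonzero integer. If the equation N_{K/ℚ}(x₁α₁ + ⋯ + x₅α₅) = m has infinitely many solutions (x₁, …, x₅) ∈ ℤ⁵, then there exist a subfield L ⊆ K with [L : ℚ] = 3, and a solution with associated value u₀ = x₁⁰α₁ + ⋯ + x₅⁰α₅ ≠ 0, such that infinitely many solutions (x₁, …, x₅) satisfy (x₁α₁ + ⋯ + x₅α₅)/u₀ ∈ L. -/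

import Mathlib

open NumberField

lemma iteratedDeriv_succ_eq_dslope {f : ℂ → ℂ} (hf : Differentiable ℂ f) (a : ℂ) (n : ℕ) :
    iteratedDeriv (n + 1) f = fun z ↦ (z - a) * iteratedDeriv (n + 1) (dslope f a) z +
      (n + 1) * iteratedDeriv n (dslope f a) z := by
  have hg : Differentiable ℂ (dslope f a) :=
    differentiableOn_univ.mp ((Complex.differentiableOn_dslope Filter.univ_mem).mpr
      hf.differentiableOn)
  have hd : ∀ m, Differentiable ℂ (iteratedDeriv m (dslope f a)) := fun m ↦
    (hg.contDiff (n := ⊤)).differentiable_iteratedDeriv m (by simp)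
  have hfe : f = fun z ↦ f a + (z - a) * dslope f a z := by
    ext z
    have := sub_smul_dslope f a z
    simp only [smul_eq_mul] at this
    rw [this]; ring
  induction n with
  | zero =>
    rw [iteratedDeriv_one]
    nth_rewrite 1 [hfe]
    ext z
    have h1 : HasDerivAt (fun z ↦ f a + (z - a) * dslope f a z)
        (1 * dslope f a z + (z - a) * deriv (dslope f a) z) z :=
      ((((hasDerivAt_id z).sub_const a).mul (hg z).hasDerivAt).const_add _)
    rw [h1.deriv, zero_add, iteratedDeriv_one, iteratedDeriv_zero]
    push_cast; ring
  | succ n ih =>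
    rw [iteratedDeriv_succ, ih]
    ext z
    have h1 : HasDerivAt (fun z ↦ (z - a) * iteratedDeriv (n + 1) (dslope f a) z +
        (n + 1) * iteratedDeriv n (dslope f a) z)
        (1 * iteratedDeriv (n + 1) (dslope f a) z +
          (z - a) * deriv (iteratedDeriv (n + 1) (dslope f a)) z +
          (n + 1) * deriv (iteratedDeriv n (dslope f a)) z) z :=
      ((((hasDerivAt_id z).sub_const a).mul (hd _ z).hasDerivAt).add
        ((hd _ z).hasDerivAt.const_mul _))
    rw [h1.deriv, ← iteratedDeriv_succ, ← iteratedDeriv_succ]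
    push_cast; ring

/-- An approximate Schwarz lemma: an entire function whose jets at the integers `l < S` are small
is small on a disc containing these integers. -/
theorem norm_le_of_small_jets {S T : ℕ} {r R : ℝ} (hr1 : 1 ≤ r) (hr : (S : ℝ) ≤ r)
    (hR : 7 * r ≤ R) (M : ℕ) :
    ∀ (τ : ℕ → ℕ) (f : ℂ → ℂ) (ε G : ℝ), Differentiable ℂ f →
      ∑ l ∈ Finset.range S, τ l = M → (∀ l, τ l ≤ T) → 0 ≤ ε → 0 ≤ G →
      (∀ z, ‖z‖ = R → ‖f z‖ ≤ G) →
      (∀ l < S, ∀ n < τ l, ‖iteratedDeriv n f l‖ ≤ ε * n.factorial) →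
      ∀ w, ‖w‖ ≤ r → ‖f w‖ ≤ G * (1 / 3) ^ M + ε * (2 * r * (T + 2)) ^ M := by
  induction M with
  | zero =>
    intro τ f ε G hf _ _ hε _ hG _ w hw
    have : ‖f w‖ ≤ G := by
      refine Complex.norm_le_of_forall_mem_frontier_norm_le (U := Metric.ball 0 R)
        Metric.isBounded_ball hf.diffContOnCl (fun z hz ↦ hG z ?_) (subset_closure ?_)
      · rw [frontier_ball _ (by linarith)] at hz
        simpa using hz
      · simp; linarith
    simpa using by linarith
  | succ M ih =>
    intro τ f ε G hf hM hT hε hG0 hG hj w hw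
    obtain ⟨a, haS, ha⟩ : ∃ a < S, 0 < τ a := by
      by_contra! h
      have : ∑ l ∈ Finset.range S, τ l = 0 :=
        Finset.sum_eq_zero fun l hl ↦ Nat.le_zero.mp (h l (Finset.mem_range.mp hl))
      omega
    set g := dslope f (a : ℂ) with hgdef
    have hg : Differentiable ℂ g := differentiableOn_univ.mp
      ((Complex.differentiableOn_dslope Filter.univ_mem).mpr hf.differentiableOn)
    have hfg : ∀ z, f z = f a + (z - a) * g z := by
      intro z
      have := sub_smul_dslope f (a : ℂ) z
      simp only [smul_eq_mul] at this
      rw [hgdef, this]; ring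
    have hfa : ‖f a‖ ≤ ε := by simpa using hj a haS 0 ha
    have haR : (a : ℝ) ≤ r := le_trans (by exact_mod_cast haS.le) hr
    have hder : ∀ n (z : ℂ), iteratedDeriv (n + 1) f z = (z - a) * iteratedDeriv (n + 1) g z +
        (n + 1) * iteratedDeriv n g z := fun n z ↦ by
      rw [iteratedDeriv_succ_eq_dslope hf a n]
    have hgjet : ∀ l < S, ∀ n < Function.update τ a (τ a - 1) l,
        ‖iteratedDeriv n g l‖ ≤ (T + 1) * ε * n.factorial := by
      intro l hl n hn
      by_cases hla : l = a
      · subst hla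
        rw [Function.update_self] at hn
        have h1 := hj l hl (n + 1) (by omega)
        rw [hder, sub_self, zero_mul, zero_add, norm_mul, Nat.factorial_succ] at h1
        have h2 : ‖((n : ℂ) + 1)‖ = n + 1 := by
          exact_mod_cast Complex.norm_natCast (n + 1)
        rw [h2] at h1
        push_cast at h1
        have h3 : ‖iteratedDeriv n g l‖ ≤ ε * n.factorial := by
          have : (0 : ℝ) < n + 1 := by positivity
          refine le_of_mul_le_mul_left ?_ this
          linarith
        refine h3.trans ?_
        have : 0 ≤ (T : ℝ) * ε * n.factorial := by positivity
        linarith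
      · rw [Function.update_of_ne hla] at hn
        have hdist : 1 ≤ ‖((l : ℂ) - a)‖ := by
          have : ((l : ℂ) - a) = (((l : ℤ) - a : ℤ) : ℂ) := by push_cast; rfl
          rw [this, Complex.norm_intCast, ← Int.cast_abs]
          have h1 : (1 : ℤ) ≤ |(l : ℤ) - a| := Int.one_le_abs (by omega)
          exact_mod_cast h1
        have key : ∀ m < τ l, ‖iteratedDeriv m g l‖ ≤ (m + 2) * ε * m.factorial := by
          intro m
          induction m with
          | zero =>
            intro hm
            have h1 : ‖f l‖ ≤ ε := by simpa using hj l hl 0 hm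
            have h2 : ((l : ℂ) - a) * g l = f l - f a := by rw [hfg l]; ring
            have h3 : ‖((l : ℂ) - a)‖ * ‖g l‖ ≤ 2 * ε := by
              rw [← norm_mul, h2]
              linarith [norm_sub_le (f l) (f a)]
            simp only [iteratedDeriv_zero]
            have := norm_nonneg (g l)
            simp
            nlinarith
          | succ m ihm =>
            intro hm
            have h0 := ihm (by omega)
            have h1 := hj l hl (m + 1) hm
            have h2 : ((l : ℂ) - a) * iteratedDeriv (m + 1) g l =
                iteratedDeriv (m + 1) f l - (m + 1) * iteratedDeriv m g l := by rw [hder]; ring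
            have h4 : ‖((m : ℂ) + 1)‖ = m + 1 := by
              exact_mod_cast Complex.norm_natCast (m + 1)
            have h3 : ‖((l : ℂ) - a)‖ * ‖iteratedDeriv (m + 1) g l‖ ≤
                ε * (m + 1).factorial + (m + 1) * ((m + 2) * ε * m.factorial) := by
              rw [← norm_mul, h2]
              refine (norm_sub_le _ _).trans ?_
              rw [norm_mul, h4]
              gcongr
            have := norm_nonneg (iteratedDeriv (m + 1) g l)
            have h5 : ‖iteratedDeriv (m + 1) g l‖ ≤
              ‖((l : ℂ) - a)‖ * ‖iteratedDeriv (m + 1) g l‖ := by nlinarith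
            refine h5.trans (h3.trans (le_of_eq ?_))
            rw [Nat.factorial_succ]; push_cast; ring
        refine (key n hn).trans ?_
        have h1 : (n : ℝ) + 1 ≤ T := by exact_mod_cast lt_of_lt_of_le hn (hT l)
        have h2 : (n : ℝ) + 2 ≤ T + 1 := by linarith
        exact mul_le_mul_of_nonneg_right (mul_le_mul_of_nonneg_right h2 hε) (by positivity)
    have hgG : ∀ z, ‖z‖ = R → ‖g z‖ ≤ (G + ε) / (6 * r) := by
      intro z hz
      have h1 : (z - a) * g z = f z - f a := by rw [hfg z]; ring
      have h2 : ‖z - a‖ * ‖g z‖ ≤ G + ε := by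
        rw [← norm_mul, h1]
        linarith [norm_sub_le (f z) (f a), hG z hz]
      have h3 : 6 * r ≤ ‖z - a‖ := by
        have := norm_sub_norm_le z (a : ℂ)
        rw [hz, Complex.norm_natCast] at this
        linarith
      rw [le_div_iff₀ (by linarith)]
      nlinarith [norm_nonneg (g z)]
    have hsum : ∑ l ∈ Finset.range S, Function.update τ a (τ a - 1) l = M := by
      have haS' : a ∈ Finset.range S := Finset.mem_range.mpr haS
      rw [Finset.sum_update_of_mem haS', ← Finset.erase_eq]
      have := Finset.add_sum_erase _ τ haS'
      omega
    have hT' : ∀ l, Function.update τ a (τ a - 1) l ≤ T := by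
      intro l
      by_cases hla : l = a
      · subst hla
        rw [Function.update_self]
        have := hT l
        omega
      · rw [Function.update_of_ne hla]
        exact hT l
    have hmain := ih _ g ((T + 1) * ε) ((G + ε) / (6 * r)) hg hsum hT' (by positivity)
      (by positivity) hgG hgjet w hw
    have hwa : ‖w - a‖ ≤ 2 * r := by
      refine (norm_sub_le _ _).trans ?_
      rw [Complex.norm_natCast]
      linarith
    set X : ℝ := (2 * r * (T + 2)) ^ M with hX
    set Y : ℝ := (1 / 3 : ℝ) ^ M with hY
    have hX1 : 1 ≤ X := by
      apply one_le_pow₀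
      have : (0 : ℝ) ≤ T := by positivity
      nlinarith
    have hY1 : Y ≤ 1 := pow_le_one₀ (by norm_num) (by norm_num)
    have hY0 : 0 ≤ Y := by positivity
    have h1 : ‖f w‖ ≤ ε + 2 * r * ((G + ε) / (6 * r) * Y + (T + 1) * ε * X) := by
      rw [hfg w]
      refine (norm_add_le _ _).trans ?_
      rw [norm_mul]
      gcongr
    have h2 : 2 * r * ((G + ε) / (6 * r) * Y) = (G + ε) * Y * (1 / 3) := by
      field_simp; ring
    rw [pow_succ, pow_succ, ← hX, ← hY]
    have e1 : ε * Y ≤ ε := by nlinarith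
    have e2 : ε ≤ ε * X := by nlinarith
    have e3 : ε * X ≤ ε * X * r := by
      have : 0 ≤ ε * X := by positivity
      nlinarith
    nlinarith

lemma iteratedDeriv_sum_const_mul_cexp {ι : Type*} [Fintype ι] (q ω : ι → ℂ) (n : ℕ) :
    iteratedDeriv n (fun z ↦ ∑ i, q i * Complex.exp (ω i * z)) =
      fun z ↦ ∑ i, q i * ω i ^ n * Complex.exp (ω i * z) := by
  induction n with
  | zero => simp
  | succ n ih =>
    rw [iteratedDeriv_succ, ih]
    ext z
    refine HasDerivAt.deriv ?_
    have : ∀ i ∈ Finset.univ, HasDerivAt (fun z ↦ q i * ω i ^ n * Complex.exp (ω i * z))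
        (q i * ω i ^ (n + 1) * Complex.exp (ω i * z)) z := fun i _ ↦ by
      have h1 : HasDerivAt (fun z ↦ ω i * z) (ω i * 1) z := (hasDerivAt_id z).const_mul _
      convert! (h1.cexp.const_mul (q i * ω i ^ n)) using 1
      ring
    exact HasDerivAt.fun_sum this

/-- The extrapolation step: a family of exponential sums, closed under differentiation, whose
values at the integers `l < S` are close to vanishing quantities, is small at all `l < S'`. -/
theorem norm_expSum_le_of_vanishing {ι : Type*} [Fintype ι] {p u v ω : ι → ℂ} {s t : ℂ}
    {a : ι → ℕ → ℂ} {B ε G : ℝ} {S S' T T' : ℕ}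
    (hω : ∀ i, ω i = s * u i + t * v i) (hs : ‖s‖ ≤ 10) (ht : ‖t‖ ≤ 10)
    (hB : ∀ i, ‖ω i‖ ≤ B) (hSS' : S ≤ S') (hS' : 1 ≤ S') (hε0 : 0 ≤ ε)
    (hε : ∀ i, ∀ l < S', ‖Complex.exp (ω i * l) - a i l‖ ≤ ε)
    (hG : ∀ m₁ < T + T', ∀ m₂ < T + T', ∑ i, ‖p i‖ * ‖u i‖ ^ m₁ * ‖v i‖ ^ m₂ ≤ G)
    (hvan : ∀ l < S, ∀ m₁ < T + T', ∀ m₂ < T + T',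
      ∑ i, p i * u i ^ m₁ * v i ^ m₂ * a i l = 0)
    {l : ℕ} (hl : l < S') {m₁ m₂ : ℕ} (hm₁ : m₁ < T) (hm₂ : m₂ < T) :
    ‖∑ i, p i * u i ^ m₁ * v i ^ m₂ * a i l‖ ≤
      G * Real.exp (7 * B * S') * (1 / 3) ^ (S * T') +
        20 ^ T' * (G * ε) * (2 * S' * (T' + 2)) ^ (S * T') + G * ε := by
  have hG0 : 0 ≤ G := le_trans (by positivity) (hG m₁ (by omega) m₂ (by omega))
  have hdiff : ∀ l < S', ∀ m₁ < T + T', ∀ m₂ < T + T',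
      ‖(∑ i, p i * u i ^ m₁ * v i ^ m₂ * Complex.exp (ω i * l)) -
        ∑ i, p i * u i ^ m₁ * v i ^ m₂ * a i l‖ ≤ G * ε := by
    intro l hl m₁ h₁ m₂ h₂
    rw [← Finset.sum_sub_distrib]
    calc _ ≤ ∑ i, ‖p i‖ * ‖u i‖ ^ m₁ * ‖v i‖ ^ m₂ * ε := by
          refine norm_sum_le_of_le _ fun i _ ↦ ?_
          rw [← mul_sub, norm_mul, norm_mul, norm_mul, norm_pow, norm_pow]
          exact mul_le_mul_of_nonneg_left (hε i l hl) (by positivity)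
      _ ≤ G * ε := by
          rw [← Finset.sum_mul]
          exact mul_le_mul_of_nonneg_right (hG m₁ h₁ m₂ h₂) hε0
  set f : ℂ → ℂ := fun z ↦ ∑ i, p i * u i ^ m₁ * v i ^ m₂ * Complex.exp (ω i * z) with hfdef
  have hfd : Differentiable ℂ f := by fun_prop
  have hS'1 : (1 : ℝ) ≤ S' := by exact_mod_cast hS'
  have hbound : ∀ z, ‖z‖ = 7 * (S' : ℝ) → ‖f z‖ ≤ G * Real.exp (7 * B * S') := by
    intro z hz
    calc _ ≤ ∑ i, ‖p i‖ * ‖u i‖ ^ m₁ * ‖v i‖ ^ m₂ * Real.exp (7 * B * S') := by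
          refine norm_sum_le_of_le _ fun i _ ↦ ?_
          rw [norm_mul, norm_mul, norm_mul, norm_pow, norm_pow]
          refine mul_le_mul_of_nonneg_left ((Complex.norm_exp_le_exp_norm _).trans ?_)
            (by positivity)
          rw [Real.exp_le_exp, norm_mul, hz]
          have := hB i
          nlinarith
      _ ≤ _ := by
          rw [← Finset.sum_mul]
          exact mul_le_mul_of_nonneg_right (hG _ (by omega) _ (by omega)) (Real.exp_nonneg _)
  have hjet : ∀ l < S, ∀ n < T', ‖iteratedDeriv n f l‖ ≤ 20 ^ T' * (G * ε) * n.factorial := by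
    intro l hl n hn
    have hval : ∀ j ∈ Finset.range (n + 1),
        ‖∑ i, p i * u i ^ (m₁ + j) * v i ^ (m₂ + (n - j)) * Complex.exp (ω i * l)‖ ≤ G * ε := by
      intro j hj
      have hj' : j ≤ n := by simpa [Nat.lt_succ_iff] using hj
      have := hdiff l (by omega) (m₁ + j) (by omega) (m₂ + (n - j)) (by omega)
      rwa [hvan l hl _ (by omega) _ (by omega), sub_zero] at this
    have heq : iteratedDeriv n f l = ∑ j ∈ Finset.range (n + 1), s ^ j * t ^ (n - j) *
        (n.choose j : ℂ) *
          ∑ i, p i * u i ^ (m₁ + j) * v i ^ (m₂ + (n - j)) * Complex.exp (ω i * l) := by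
      rw [hfdef, iteratedDeriv_sum_const_mul_cexp]
      simp_rw [Finset.mul_sum]
      rw [Finset.sum_comm]
      refine Finset.sum_congr rfl fun i _ ↦ ?_
      rw [show p i * u i ^ m₁ * v i ^ m₂ * ω i ^ n = p i * u i ^ m₁ * v i ^ m₂ *
        (s * u i + t * v i) ^ n by rw [hω], add_pow, Finset.mul_sum, Finset.sum_mul]
      refine Finset.sum_congr rfl fun j _ ↦ ?_
      rw [mul_pow, mul_pow, pow_add, pow_add]
      ring
    rw [heq]
    calc _ ≤ ∑ j ∈ Finset.range (n + 1), 10 ^ j * 10 ^ (n - j) * (n.choose j : ℝ) * (G * ε) := by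
          refine norm_sum_le_of_le _ fun j hj ↦ ?_
          rw [norm_mul, norm_mul, norm_mul, norm_pow, norm_pow, Complex.norm_natCast]
          have := hval j hj
          gcongr
      _ = 20 ^ n * (G * ε) := by
          rw [← Finset.sum_mul, ← add_pow]
          norm_num
      _ ≤ 20 ^ T' * (G * ε) * 1 := by
          rw [mul_one]
          gcongr
          norm_num
      _ ≤ _ := by
          gcongr
          exact_mod_cast Nat.factorial_pos n
  have hschw := norm_le_of_small_jets (T := T') hS'1 (by exact_mod_cast hSS') le_rfl (S * T')
    (fun _ ↦ T') f (20 ^ T' * (G * ε)) (G * Real.exp (7 * B * S')) hfd (by simp)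
    (fun _ ↦ le_rfl) (by positivity) (by positivity) hbound hjet l
    (by rw [Complex.norm_natCast]; exact_mod_cast hl.le)
  have h2 := hdiff l hl m₁ (by omega) m₂ (by omega)
  have h3 := norm_sub_norm_le (∑ i, p i * u i ^ m₁ * v i ^ m₂ * a i l)
    (∑ i, p i * u i ^ m₁ * v i ^ m₂ * Complex.exp (ω i * l))
  rw [norm_sub_rev] at h3
  linarith

/-- Liouville's inequality for a nonzero algebraic integer. -/
lemma one_le_norm_mul_house_pow {K : Type*} [Field K] [NumberField K] (φ : K →+* ℂ) {z : 𝓞 K}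
    (hz : z ≠ 0) : 1 ≤ ‖φ z‖ * house (z : K) ^ (Module.finrank ℚ K - 1) := by
  refine le_trans ?_ (norm_norm_le_norm_mul_house_pow (z : K) φ)
  have h0 : Algebra.norm ℤ z ≠ 0 := Algebra.norm_ne_zero_iff.mpr hz
  have h1 : Algebra.norm ℚ (z : K) = ((Algebra.norm ℤ z : ℤ) : ℚ) := by
    rw [Algebra.coe_norm_int]
  rw [h1, ← Rat.norm_cast_real]
  push_cast
  rw [Real.norm_eq_abs, ← Int.cast_abs]
  exact_mod_cast Int.one_le_abs h0

/-- Siegel's lemma over the ring of integers of a number field. -/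
lemma exists_siegel_solution (K : Type*) [Field K] [NumberField K] :
    ∃ C : ℝ, 1 ≤ C ∧ ∀ (α β : Type) [Fintype α] [Fintype β] (a : Matrix α β (𝓞 K)) (A : ℝ),
      1 ≤ A → (∀ k l, house (a k l : K) ≤ A) → 0 < Fintype.card α →
      2 * Fintype.card α ≤ Fintype.card β →
      ∃ ξ : β → 𝓞 K, ξ ≠ 0 ∧ a.mulVec ξ = 0 ∧
        ∀ l, house (ξ l : K) ≤ C * (C * Fintype.card β * A) := by
  classical
  obtain ⟨c, hc⟩ : ∃ c : ℝ, ∀ (α β : Type) [Fintype α] [Fintype β] (a : Matrix α β (𝓞 K))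
      (p q : ℕ) (A : ℝ), a ≠ 0 → 0 < p → p < q → Fintype.card α = p → Fintype.card β = q →
      (∀ k l, house (a k l : K) ≤ A) →
      ∃ ξ : β → 𝓞 K, ξ ≠ 0 ∧ a.mulVec ξ = 0 ∧
        ∀ l, house (ξ l : K) ≤ c * (c * q * A) ^ ((p : ℝ) / (q - p)) :=
    ⟨_, fun α β _ _ a p q A ha h0 hpq hα hβ h ↦
      house.exists_ne_zero_int_vec_house_le K a ha h0 hpq hβ h hα⟩
  refine ⟨max 1 |c|, le_max_left _ _, fun α β _ _ a A hA ha hα hαβ ↦ ?_⟩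
  set C := max 1 |c| with hC
  have hC1 : 1 ≤ C := le_max_left _ _
  have hcC : |c| ≤ C := le_max_right _ _
  have hβ1 : (1 : ℝ) ≤ Fintype.card β := by exact_mod_cast (by omega : 1 ≤ Fintype.card β)
  have hbase : 1 ≤ C * Fintype.card β * A := by
    have := one_le_mul_of_one_le_of_one_le hC1 hβ1
    exact one_le_mul_of_one_le_of_one_le this hA
  by_cases h0 : a = 0
  · refine ⟨fun _ ↦ 1, ?_, by simp [h0], fun l ↦ ?_⟩
    · have : Nonempty β := Fintype.card_pos_iff.mp (by omega)
      exact Function.ne_iff.mpr ⟨Classical.arbitrary β, by simp⟩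
    · have : house ((1 : 𝓞 K) : K) = 1 := by
        have := house_intCast (K := K) 1
        simpa using this
      rw [this]
      exact one_le_mul_of_one_le_of_one_le hC1 hbase
  · obtain ⟨ξ, h1, h2, h3⟩ := hc α β a _ _ A h0 hα (by omega) rfl rfl ha
    refine ⟨ξ, h1, h2, fun l ↦ (h3 l).trans ?_⟩
    set e : ℝ := (Fintype.card α : ℝ) / (Fintype.card β - Fintype.card α) with he
    have hαβ' : 2 * (Fintype.card α : ℝ) ≤ Fintype.card β := by exact_mod_cast hαβ
    have hα' : 0 < (Fintype.card α : ℝ) := by exact_mod_cast hα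
    have he0 : 0 ≤ e := div_nonneg hα'.le (by linarith)
    have he1 : e ≤ 1 := by
      rw [he, div_le_one (by linarith)]; linarith
    calc _ ≤ |c * (c * Fintype.card β * A) ^ e| := le_abs_self _
      _ ≤ |c| * |c * Fintype.card β * A| ^ e := by
        rw [abs_mul]
        gcongr
        exact Real.abs_rpow_le_abs_rpow _ _
      _ ≤ C * (C * Fintype.card β * A) ^ e := by
        have : |c * Fintype.card β * A| ≤ C * Fintype.card β * A := by
          rw [abs_mul, abs_mul, abs_of_nonneg (by linarith : 0 ≤ A), Nat.abs_cast]
          gcongr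
        gcongr
      _ ≤ C * (C * Fintype.card β * A) ^ (1 : ℝ) := by
        gcongr
      _ = _ := by rw [Real.rpow_one]

/-- The algebraic value at `l` of the monomial with exponents `i`. -/
def auxMonomial {R : Type*} [CommRing R] (θ x y : R) {L : ℕ} (i : Fin L × Fin L × Fin L)
    (l : ℕ) : R :=
  θ ^ (i.1 * l) * x ^ (i.2.1 * l) * y ^ ((L - i.2.1) * l)

/-- The auxiliary sums whose simultaneous vanishing is propagated. -/
def auxSum {R : Type*} [CommRing R] (θ x y : R) (k j b : ℕ) {L : ℕ}
    (P : Fin L × Fin L × Fin L → R) (m₁ m₂ l : ℕ) : R :=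
  ∑ i, P i * ((j * i.1 + i.2.2 * k : ℕ) : R) ^ m₁ * ((j * i.2.1 + i.2.2 * b : ℕ) : R) ^ m₂ *
    auxMonomial θ x y i l

lemma house_auxMonomial_le {K : Type*} [Field K] [NumberField K] {θ x y : 𝓞 K} {h : ℝ}
    (h0 : 0 ≤ h) (hθ : house (θ : K) ≤ Real.exp h) (hx : house (x : K) ≤ Real.exp h)
    (hy : house (y : K) ≤ Real.exp h) {L : ℕ} (i : Fin L × Fin L × Fin L) (l : ℕ) :
    house ((auxMonomial θ x y i l : 𝓞 K) : K) ≤ Real.exp (2 * h * L * l) := by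
  have hpow : ∀ (z : 𝓞 K) (n : ℕ), house (z : K) ≤ Real.exp h →
      house ((z : K) ^ n) ≤ Real.exp (h * n) := fun z n hz ↦ by
    refine (house_pow_le _ _).trans ?_
    rw [mul_comm, Real.exp_nat_mul]
    exact pow_le_pow_left₀ (house_nonneg _) hz _
  simp only [auxMonomial, map_mul, map_pow]
  calc _ ≤ Real.exp (h * (i.1 * l : ℕ)) * Real.exp (h * (i.2.1 * l : ℕ)) *
        Real.exp (h * ((L - i.2.1) * l : ℕ)) := by
        refine (house_mul_le _ _).trans (mul_le_mul ((house_mul_le _ _).trans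
          (mul_le_mul (hpow _ _ hθ) (hpow _ _ hx) (house_nonneg _) (Real.exp_nonneg _)))
          (hpow _ _ hy) (house_nonneg _) (by positivity))
    _ ≤ _ := by
        rw [← Real.exp_add, ← Real.exp_add, Real.exp_le_exp]
        have h1 : (i.1 : ℕ) * l ≤ L * l := Nat.mul_le_mul_right _ i.1.2.le
        have h2 : (i.2.1 : ℕ) * l + (L - i.2.1) * l = L * l := by
          rw [← Nat.add_mul, Nat.add_sub_cancel' i.2.1.2.le]
        have h1' : (((i.1 : ℕ) * l : ℕ) : ℝ) ≤ L * l := by exact_mod_cast h1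
        have h2' : (((i.2.1 : ℕ) * l : ℕ) : ℝ) + ((L - i.2.1) * l : ℕ) = L * l := by
          exact_mod_cast h2
        rw [← mul_add, ← mul_add, add_assoc, h2']
        nlinarith

/-- The zero estimate: enough vanishing forces all coefficients to vanish. -/
theorem eq_zero_of_auxSum_eq_zero {K : Type*} [Field K] [NumberField K] (φ : K →+* ℂ)
    {θ x y : 𝓞 K} (hy : y ≠ 0) {k j b L S T : ℕ} (hk : 1 ≤ k)
    (hinj : ∀ b c b' c' : ℕ, b < L → c < L → b' < L → c' < L →
      φ θ ^ b * (φ x / φ y) ^ c = φ θ ^ b' * (φ x / φ y) ^ c' → b = b' ∧ c = c')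
    (hS : L * L ≤ S) (hT : L ≤ T) {P : Fin L × Fin L × Fin L → 𝓞 K}
    (hvan : ∀ l < S, ∀ m₁ < T, ∀ m₂ < T, auxSum θ x y k j b P m₁ m₂ l = 0) : P = 0 := by
  rcases Nat.eq_zero_or_pos L with rfl | hL
  · exact funext fun i ↦ i.1.elim0
  have hφy : φ y ≠ 0 := (map_ne_zero φ).mpr (by simpa using hy)
  -- the numbers `θ ^ b * γ ^ c` are pairwise distinct
  set z : Fin L × Fin L → ℂ := fun q ↦ φ θ ^ (q.1 : ℕ) * (φ x / φ y) ^ (q.2 : ℕ) with hz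
  have hzinj : Function.Injective z := by
    intro q q' h
    obtain ⟨h1, h2⟩ := hinj _ _ _ _ q.1.2 q.2.2 q'.1.2 q'.2.2 h
    exact Prod.ext (Fin.ext h1) (Fin.ext h2)
  have hmon : ∀ (i : Fin L × Fin L × Fin L) (l : ℕ),
      φ (auxMonomial θ x y i l : 𝓞 K) = φ y ^ (L * l) * z (i.1, i.2.1) ^ l := by
    intro i l
    have h2 : L * l = (i.2.1 : ℕ) * l + (L - i.2.1) * l := by
      rw [← Nat.add_mul, Nat.add_sub_cancel' i.2.1.2.le]
    simp only [auxMonomial, map_mul, map_pow, hz]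
    rw [h2, mul_pow, ← pow_mul, div_pow, pow_add, div_pow, ← pow_mul, ← pow_mul]
    field_simp
  have step1 : ∀ m < L, ∀ q : Fin L × Fin L,
      ∑ d : Fin L, φ (P (q.1, q.2, d)) * ((j * q.1 + d * k : ℕ) : ℂ) ^ m = 0 := by
    intro m hm
    set e := (Fintype.equivFin (Fin L × Fin L))
    have hcard : Fintype.card (Fin L × Fin L) = L * L := by simp
    set w : Fin L × Fin L → ℂ := fun q ↦
      ∑ d : Fin L, φ (P (q.1, q.2, d)) * ((j * q.1 + d * k : ℕ) : ℂ) ^ m with hw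
    have hw0 : (fun s ↦ w (e.symm s)) = 0 := by
      refine Matrix.eq_zero_of_forall_pow_sum_mul_pow_eq_zero
        (f := fun s ↦ z (e.symm s)) (hzinj.comp e.symm.injective) fun l ↦ ?_
      rw [e.symm.sum_comp (fun q ↦ w q * z q ^ (l : ℕ))]
      have h1 := hvan l (lt_of_lt_of_le (l.2.trans_eq hcard) hS) m (by omega) 0 (by omega)
      have h2 : φ (auxSum θ x y k j b P m 0 l : 𝓞 K) = 0 := by rw [h1]; simp
      simp only [auxSum, map_sum, map_mul, map_pow, hmon, pow_zero, mul_one, map_natCast] at h2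
      rw [Fintype.sum_prod_type] at h2
      simp_rw [Fintype.sum_prod_type] at h2
      rw [Fintype.sum_prod_type]
      have h3 : φ y ^ (L * (l : ℕ)) * ∑ x, ∑ y, w (x, y) * z (x, y) ^ (l : ℕ) = 0 := by
        rw [← h2]
        simp only [hw, Finset.mul_sum, Finset.sum_mul]
        refine Finset.sum_congr rfl fun _ _ ↦ Finset.sum_congr rfl fun _ _ ↦
          Finset.sum_congr rfl fun _ _ ↦ ?_
        ring
      exact (mul_eq_zero.mp h3).resolve_left (pow_ne_zero _ hφy)
    intro q
    have : w q = 0 := by simpa using congrFun hw0 (e q)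
    exact this
  funext ⟨b', c', d'⟩
  have h0 : (fun d : Fin L ↦ φ (P (b', c', d))) = 0 := by
    refine Matrix.eq_zero_of_forall_pow_sum_mul_pow_eq_zero
      (f := fun d : Fin L ↦ ((j * b' + d * k : ℕ) : ℂ)) (fun d d' h ↦ ?_)
      fun m ↦ step1 m m.2 (b', c')
    have h'' : ((j * b' + d * k : ℕ) : ℂ) = ((j * b' + d' * k : ℕ) : ℂ) := h
    have h' : j * (b' : ℕ) + d * k = j * b' + d' * k := by exact_mod_cast h''
    exact Fin.ext (Nat.eq_of_mul_eq_mul_right hk (by omega))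
  have := congrFun h0 d'
  simpa using this

section Frequencies

variable {lθ lγ : ℂ} {j k b₀ : ℕ}

lemma frequency_eq (hj : 1 ≤ j) (b c d : ℕ) :
    lθ / j * (j * b + d * k : ℕ) + lγ / j * (j * c + d * b₀ : ℕ) =
      b * lθ + c * lγ + d * (2 * Real.pi * Complex.I) +
        d * ((k * lθ + b₀ * lγ - 2 * Real.pi * Complex.I * j) / j) := by
  have : (j : ℂ) ≠ 0 := by exact_mod_cast (by omega : j ≠ 0)
  push_cast
  field_simp
  ring

lemma norm_frequency_le (hj : 1 ≤ j) (hθ : ‖lθ‖ ≤ 10) (hγ : ‖lγ‖ ≤ 10)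
    (hΛ : ‖k * lθ + b₀ * lγ - 2 * Real.pi * Complex.I * j‖ ≤ 1) {b c d L : ℕ}
    (hb : b ≤ L) (hc : c ≤ L) (hd : d ≤ L) :
    ‖lθ / j * (j * b + d * k : ℕ) + lγ / j * (j * c + d * b₀ : ℕ)‖ ≤ 28 * L := by
  rw [frequency_eq hj]
  set Λ := k * lθ + b₀ * lγ - 2 * Real.pi * Complex.I * j
  have hb' : (b : ℝ) ≤ L := by exact_mod_cast hb
  have hc' : (c : ℝ) ≤ L := by exact_mod_cast hc
  have hd' : (d : ℝ) ≤ L := by exact_mod_cast hd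
  have hj' : (1 : ℝ) ≤ j := by exact_mod_cast hj
  have h1 : ‖(b : ℂ) * lθ‖ ≤ L * 10 := by
    rw [norm_mul, Complex.norm_natCast]; gcongr
  have h2 : ‖(c : ℂ) * lγ‖ ≤ L * 10 := by
    rw [norm_mul, Complex.norm_natCast]; gcongr
  have h3 : ‖(d : ℂ) * (2 * Real.pi * Complex.I)‖ ≤ L * 7 := by
    have h7 : ‖(2 * Real.pi * Complex.I : ℂ)‖ ≤ 7 := by
      have := Real.pi_lt_d2
      simp [abs_of_pos Real.pi_pos]; linarith
    rw [norm_mul, Complex.norm_natCast]; gcongr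
  have h4 : ‖(d : ℂ) * (Λ / j)‖ ≤ L * 1 := by
    have : ‖Λ / j‖ ≤ 1 := by
      rw [norm_div, Complex.norm_natCast, div_le_one (by linarith)]
      linarith
    rw [norm_mul, Complex.norm_natCast]; gcongr
  have := norm_add₄_le (a := (b : ℂ) * lθ) (b := c * lγ) (c := d * (2 * Real.pi * Complex.I))
    (d := d * (Λ / j))
  linarith

lemma norm_exp_frequency_sub_le (hj : 1 ≤ j) (hθ : ‖lθ‖ ≤ 10) (hγ : ‖lγ‖ ≤ 10) {L S : ℕ}
    (hΛ : L * S * ‖k * lθ + b₀ * lγ - 2 * Real.pi * Complex.I * j‖ ≤ 1) {b c d l : ℕ}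
    (hb : b ≤ L) (hc : c ≤ L) (hd : d ≤ L) (hl : l ≤ S) :
    ‖Complex.exp ((lθ / j * (j * b + d * k : ℕ) + lγ / j * (j * c + d * b₀ : ℕ)) * l) -
      Complex.exp lθ ^ (b * l) * Complex.exp lγ ^ (c * l)‖ ≤
      Real.exp (20 * L * S) *
        (2 * (L * S * ‖k * lθ + b₀ * lγ - 2 * Real.pi * Complex.I * j‖)) := by
  rw [frequency_eq hj]
  set Λ := k * lθ + b₀ * lγ - 2 * Real.pi * Complex.I * j
  have hb' : (b : ℝ) ≤ L := by exact_mod_cast hb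
  have hc' : (c : ℝ) ≤ L := by exact_mod_cast hc
  have hd' : (d : ℝ) ≤ L := by exact_mod_cast hd
  have hl' : (l : ℝ) ≤ S := by exact_mod_cast hl
  have hj' : (1 : ℝ) ≤ j := by exact_mod_cast hj
  have hsmall : ‖(d : ℂ) * (Λ / j) * l‖ ≤ L * S * ‖Λ‖ := by
    rw [norm_mul, norm_mul, Complex.norm_natCast, Complex.norm_natCast, norm_div,
      Complex.norm_natCast]
    have : ‖Λ‖ / j ≤ ‖Λ‖ := div_le_self (norm_nonneg _) hj'
    calc _ ≤ (L : ℝ) * ‖Λ‖ * S := by gcongr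
      _ = _ := by ring
  have hexp : Complex.exp ((b * lθ + c * lγ + d * (2 * Real.pi * Complex.I) + d * (Λ / j)) * l) =
      Complex.exp lθ ^ (b * l) * Complex.exp lγ ^ (c * l) *
        Complex.exp ((d : ℂ) * (Λ / j) * l) := by
    rw [← Complex.exp_nat_mul, ← Complex.exp_nat_mul, ← Complex.exp_add, ← Complex.exp_add,
      Complex.exp_eq_exp_iff_exists_int]
    refine ⟨d * l, ?_⟩
    push_cast
    ring
  have hmain : ‖Complex.exp lθ ^ (b * l) * Complex.exp lγ ^ (c * l)‖ ≤
      Real.exp (20 * L * S) := by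
    rw [← Complex.exp_nat_mul, ← Complex.exp_nat_mul, ← Complex.exp_add]
    refine (Complex.norm_exp_le_exp_norm _).trans (Real.exp_le_exp.mpr ?_)
    have h1 : ‖((b * l : ℕ) : ℂ) * lθ‖ ≤ L * S * 10 := by
      rw [norm_mul, Complex.norm_natCast]; push_cast; gcongr
    have h2 : ‖((c * l : ℕ) : ℂ) * lγ‖ ≤ L * S * 10 := by
      rw [norm_mul, Complex.norm_natCast]; push_cast; gcongr
    linarith [norm_add_le (((b * l : ℕ) : ℂ) * lθ) (((c * l : ℕ) : ℂ) * lγ)]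
  rw [hexp, ← mul_sub_one, norm_mul]
  have := Complex.norm_exp_sub_one_le (hsmall.trans hΛ)
  gcongr
  linarith

end Frequencies

lemma map_auxMonomial {K : Type*} [Field K] [NumberField K] (φ : K →+* ℂ) {θ x y : 𝓞 K}
    (hy : y ≠ 0) {L : ℕ} (i : Fin L × Fin L × Fin L) (l : ℕ) :
    φ (auxMonomial θ x y i l : 𝓞 K) =
      φ y ^ (L * l) * (φ θ ^ ((i.1 : ℕ) * l) * (φ x / φ y) ^ ((i.2.1 : ℕ) * l)) := by
  have hφy : φ y ≠ 0 := (map_ne_zero φ).mpr (by simpa using hy)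
  have h2 : L * l = (i.2.1 : ℕ) * l + (L - i.2.1) * l := by
    rw [← Nat.add_mul, Nat.add_sub_cancel' i.2.1.2.le]
  simp only [auxMonomial, map_mul, map_pow]
  rw [h2, pow_add, div_pow]
  field_simp

lemma map_auxSum {K : Type*} [Field K] [NumberField K] (φ : K →+* ℂ) {θ x y : 𝓞 K}
    (hy : y ≠ 0) {k j b₀ L : ℕ} (P : Fin L × Fin L × Fin L → 𝓞 K) (m₁ m₂ l : ℕ) :
    φ (auxSum θ x y k j b₀ P m₁ m₂ l : 𝓞 K) = φ y ^ (L * l) *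
      ∑ i, φ (P i) * ((j * i.1 + i.2.2 * k : ℕ) : ℂ) ^ m₁ *
        ((j * i.2.1 + i.2.2 * b₀ : ℕ) : ℂ) ^ m₂ *
        (φ θ ^ ((i.1 : ℕ) * l) * (φ x / φ y) ^ ((i.2.1 : ℕ) * l)) := by
  simp only [auxSum, map_sum, map_mul, map_pow, map_auxMonomial φ hy, map_natCast]
  rw [Finset.mul_sum]
  exact Finset.sum_congr rfl fun _ _ ↦ by ring

lemma house_natCast_mul_pow_le {K : Type*} [Field K] [NumberField K] (u v m₁ m₂ : ℕ) (z : K) :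
    house (((u : K) ^ m₁ * (v : K) ^ m₂) * z) ≤ (u : ℝ) ^ m₁ * (v : ℝ) ^ m₂ * house z := by
  have h : ((u : K) ^ m₁ * (v : K) ^ m₂) = ((u ^ m₁ * v ^ m₂ : ℕ) : K) := by push_cast; rfl
  rw [h, house_nat_mul]
  push_cast
  rfl

lemma mul_pow_le_pow_succ {n c : ℝ} (hc : c ≤ n) (hn1 : 1 ≤ n) {a b : ℕ}
    (hab : a + 1 ≤ b) : c * n ^ a ≤ n ^ b := by
  have : 0 ≤ n := by linarith
  calc c * n ^ a ≤ n * n ^ a := by gcongr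
    _ = n ^ (a + 1) := by ring
    _ ≤ n ^ b := pow_le_pow_right₀ hn1 hab

lemma sum_weights_le {N : ℕ} (hN : 1000 ≤ N) (hexp : (N : ℝ) ^ 40 ≤ Real.exp N)
    {p U V : Fin (N ^ 10) × Fin (N ^ 10) × Fin (N ^ 10) → ℝ} (hp0 : ∀ i, 0 ≤ p i)
    (hp : ∀ i, p i ≤ Real.exp (N ^ 15)) (hU0 : ∀ i, 0 ≤ U i) (hV0 : ∀ i, 0 ≤ V i)
    (hU : ∀ i, U i ≤ Real.exp (2 * N)) (hV : ∀ i, V i ≤ Real.exp (2 * N)) {m₁ m₂ : ℕ}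
    (h₁ : m₁ < 18 * N ^ 13) (h₂ : m₂ < 18 * N ^ 13) :
    ∑ i, p i * U i ^ m₁ * V i ^ m₂ ≤ Real.exp (2 * N ^ 15) := by
  have hn : (1000 : ℝ) ≤ N := by exact_mod_cast hN
  have hpow : ∀ x : ℝ, 0 ≤ x → x ≤ Real.exp (2 * N) → ∀ m < 18 * N ^ 13,
      x ^ m ≤ Real.exp (36 * N ^ 14) := by
    intro x hx0 hx m hm
    have hm' : (m : ℝ) ≤ 18 * N ^ 13 := by exact_mod_cast hm.le
    calc x ^ m ≤ Real.exp (2 * N) ^ m := pow_le_pow_left₀ hx0 hx m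
      _ = Real.exp (m * (2 * N)) := (Real.exp_nat_mul _ _).symm
      _ ≤ Real.exp (18 * N ^ 13 * (2 * N)) := by gcongr
      _ = _ := by ring_nf
  calc ∑ i, p i * U i ^ m₁ * V i ^ m₂
      ≤ ∑ _i : Fin (N ^ 10) × Fin (N ^ 10) × Fin (N ^ 10),
        Real.exp (N ^ 15) * Real.exp (36 * N ^ 14) * Real.exp (36 * N ^ 14) := by
        refine Finset.sum_le_sum fun i _ ↦ ?_
        have := hp0 i
        have := hU0 i
        have := hV0 i
        exact mul_le_mul (mul_le_mul (hp i) (hpow _ (hU0 i) (hU i) _ h₁) (by positivity)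
          (by positivity)) (hpow _ (hV0 i) (hV i) _ h₂) (by positivity) (by positivity)
    _ = (N : ℝ) ^ 30 *
        (Real.exp (N ^ 15) * Real.exp (36 * N ^ 14) * Real.exp (36 * N ^ 14)) := by
        simp only [Finset.sum_const, Finset.card_univ, Fintype.card_prod, Fintype.card_fin,
          nsmul_eq_mul]
        push_cast
        ring
    _ ≤ Real.exp N *
        (Real.exp (N ^ 15) * Real.exp (36 * N ^ 14) * Real.exp (36 * N ^ 14)) := by
        gcongr
        exact (pow_le_pow_right₀ (by linarith) (by norm_num)).trans hexp
    _ ≤ _ := by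
        rw [← Real.exp_add, ← Real.exp_add, ← Real.exp_add, Real.exp_le_exp]
        have h1 := mul_pow_le_pow_succ (c := 100) (a := 14) (b := 15) (by linarith)
          (by linarith : (1 : ℝ) ≤ N) le_rfl
        have h2 : (N : ℝ) ≤ N ^ 14 := le_self_pow₀ (by linarith) (by norm_num)
        linarith

lemma extrapolation_bound_lt {N d i : ℕ} (hN : 1000 ≤ N) (hd : 4 * d + 5 ≤ N)
    (hexp : (N : ℝ) ^ 40 ≤ Real.exp N) (hi : i ≤ 16) {δ ε : ℝ} (hδ0 : 0 ≤ δ)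
    (hδ : δ ≤ Real.exp (-N ^ 40))
    (hε : ε = Real.exp (20 * (N ^ 10 : ℕ) * (N ^ (4 + i) : ℕ)) *
      (2 * ((N ^ 10 : ℕ) * (N ^ (4 + i) : ℕ) * δ))) :
    Real.exp (2 * N ^ 15) * Real.exp (7 * (28 * (N ^ 10 : ℕ)) * (N ^ (4 + i) : ℕ)) *
        (1 / 3) ^ (N ^ (3 + i) * N ^ 13) +
      20 ^ (N ^ 13) * (Real.exp (2 * N ^ 15) * ε) *
        (2 * (N ^ (4 + i) : ℕ) * ((N ^ 13 : ℕ) + 2)) ^ (N ^ (3 + i) * N ^ 13) +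
      Real.exp (2 * N ^ 15) * ε < Real.exp (-(4 * d * N ^ (15 + i))) := by
  have hn : (1000 : ℝ) ≤ N := by exact_mod_cast hN
  have hn1 : (1 : ℝ) ≤ N := by linarith
  have hn0 : (0 : ℝ) ≤ N := by linarith
  push_cast at hε ⊢
  set n : ℝ := (N : ℝ)
  have hd' : 4 * (d : ℝ) + 5 ≤ n := by
    simp only [n]; exact_mod_cast hd
  have hle : ∀ a b : ℕ, a ≤ b → n ^ a ≤ n ^ b := fun a b h ↦ pow_le_pow_right₀ hn1 h
  have hX1 : 1 ≤ n ^ (15 + i) := one_le_pow₀ hn1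
  have hε0 : 0 ≤ ε := by rw [hε]; positivity
  have hε' : ε ≤ Real.exp (21 * n ^ 30 - n ^ 40) := by
    have h1 : n ^ 10 * n ^ (4 + i) ≤ n ^ 30 := by
      rw [← pow_add]; exact hle _ _ (by omega)
    have h2 : 2 * n ^ 30 ≤ Real.exp n :=
      (mul_pow_le_pow_succ (by linarith) hn1 (by norm_num)).trans hexp
    calc ε ≤ Real.exp (20 * n ^ 30) * (Real.exp n * Real.exp (-n ^ 40)) := by
          rw [hε, mul_assoc 20]
          refine mul_le_mul (Real.exp_le_exp.mpr (by linarith)) ?_ (by positivity) (by positivity)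
          rw [← mul_assoc]
          refine mul_le_mul (by linarith) hδ hδ0 (Real.exp_nonneg _)
      _ ≤ _ := by
          rw [← Real.exp_add, ← Real.exp_add, Real.exp_le_exp]
          have : n ≤ n ^ 30 := le_self_pow₀ hn1 (by norm_num)
          linarith
  have hGε : Real.exp (2 * n ^ 15) * ε ≤ Real.exp (23 * n ^ 30 - n ^ 40) := by
    calc _ ≤ Real.exp (2 * n ^ 15) * Real.exp (21 * n ^ 30 - n ^ 40) := by gcongr
      _ ≤ _ := by
        rw [← Real.exp_add, Real.exp_le_exp]
        have := hle 15 30 (by norm_num)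
        linarith
  have h33 : n ^ (17 + i) ≤ n ^ 33 := hle _ _ (by omega)
  have h40 : 100 * n ^ 33 ≤ n ^ 40 := mul_pow_le_pow_succ (by linarith) hn1 (by norm_num)
  have h30 : 30 * n ^ 30 ≤ n ^ 33 := mul_pow_le_pow_succ (by linarith) hn1 (by norm_num)
  have h13 : 20 * n ^ 13 ≤ n ^ 33 := mul_pow_le_pow_succ (by linarith) hn1 (by norm_num)
  have hterm2 : 20 ^ (N ^ 13) * (Real.exp (2 * n ^ 15) * ε) *
      (2 * n ^ (4 + i) * (n ^ 13 + 2)) ^ (N ^ (3 + i) * N ^ 13) ≤ Real.exp (-n ^ 33) := by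
    have h20 : (20 : ℝ) ^ (N ^ 13) ≤ Real.exp (20 * n ^ 13) := by
      calc (20 : ℝ) ^ (N ^ 13) ≤ Real.exp 20 ^ (N ^ 13) := by
            gcongr
            linarith [Real.add_one_le_exp (20 : ℝ)]
        _ = _ := by
            rw [← Real.exp_nat_mul]; push_cast; ring_nf; rfl
    have hbase : 2 * n ^ (4 + i) * (n ^ 13 + 2) ≤ Real.exp n := by
      refine le_trans ?_ hexp
      have h1 := hle (4 + i) 20 (by omega)
      have h2 : (2 : ℝ) ≤ n ^ 13 := le_trans (by linarith) (le_self_pow₀ hn1 (by norm_num))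
      calc _ ≤ 2 * n ^ 20 * (n ^ 13 + n ^ 13) := by gcongr
        _ = 4 * n ^ 33 := by ring
        _ ≤ n ^ 40 := mul_pow_le_pow_succ (by linarith) hn1 (by norm_num)
    have hp : (2 * n ^ (4 + i) * (n ^ 13 + 2)) ^ (N ^ (3 + i) * N ^ 13) ≤
        Real.exp (n ^ (17 + i)) := by
      calc _ ≤ Real.exp n ^ (N ^ (3 + i) * N ^ 13) := pow_le_pow_left₀ (by positivity) hbase _
        _ = _ := by
          rw [← Real.exp_nat_mul]
          push_cast
          congr 1
          simp only [n]
          ring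
    calc _ ≤ Real.exp (20 * n ^ 13) * Real.exp (23 * n ^ 30 - n ^ 40) *
          Real.exp (n ^ (17 + i)) := by gcongr
      _ ≤ _ := by
        rw [← Real.exp_add, ← Real.exp_add, Real.exp_le_exp]
        have : 0 ≤ n ^ 33 := by positivity
        linarith
  have hterm1 : Real.exp (2 * n ^ 15) * Real.exp (7 * (28 * n ^ 10) * n ^ (4 + i)) *
      (1 / 3) ^ (N ^ (3 + i) * N ^ 13) ≤ Real.exp ((3 - n) * n ^ (15 + i)) := by
    have h3 : ((1 : ℝ) / 3) ^ (N ^ (3 + i) * N ^ 13) ≤ Real.exp (-n ^ (16 + i)) := by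
      calc ((1 : ℝ) / 3) ^ (N ^ (3 + i) * N ^ 13) ≤ Real.exp (-1) ^ (N ^ (3 + i) * N ^ 13) := by
            gcongr
            rw [Real.exp_neg, one_div]
            exact inv_anti₀ (Real.exp_pos _) (by linarith [Real.exp_one_lt_d9])
        _ = _ := by
          rw [← Real.exp_nat_mul]
          push_cast
          congr 1
          simp only [n]
          ring
    calc _ ≤ Real.exp (2 * n ^ 15) * Real.exp (7 * (28 * n ^ 10) * n ^ (4 + i)) *
          Real.exp (-n ^ (16 + i)) := by gcongr
      _ ≤ _ := by
        rw [← Real.exp_add, ← Real.exp_add, Real.exp_le_exp]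
        have h1 := hle 15 (15 + i) (by omega)
        have h2 : 196 * n ^ (14 + i) ≤ n ^ (15 + i) :=
          mul_pow_le_pow_succ (by linarith) hn1 (by omega)
        have h4 : 7 * (28 * n ^ 10) * n ^ (4 + i) = 196 * n ^ (14 + i) := by ring
        have h5 : n ^ (16 + i) = n * n ^ (15 + i) := by ring
        rw [h4, h5]
        linarith
  have h32 : (n - 3) * n ^ (15 + i) ≤ n ^ 33 := by
    calc _ ≤ n * n ^ (15 + i) := by gcongr; linarith
      _ = n ^ (16 + i) := by ring
      _ ≤ _ := hle _ _ (by omega)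
  have hA : Real.exp (-n ^ 33) ≤ Real.exp ((3 - n) * n ^ (15 + i)) :=
    Real.exp_le_exp.mpr (by linarith)
  have h330 : 0 ≤ n ^ 33 := by positivity
  have hB : Real.exp (2 * n ^ 15) * ε ≤ Real.exp ((3 - n) * n ^ (15 + i)) :=
    (hGε.trans (Real.exp_le_exp.mpr (by linarith))).trans hA
  have hfin : 3 * Real.exp ((3 - n) * n ^ (15 + i)) < Real.exp (-(4 * d * n ^ (15 + i))) := by
    have h3 : (3 : ℝ) < Real.exp (2 * n ^ (15 + i)) := by
      calc (3 : ℝ) ≤ 2 * n ^ (15 + i) + 1 := by linarith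
        _ < _ := Real.add_one_lt_exp (by linarith)
    calc _ < Real.exp (2 * n ^ (15 + i)) * Real.exp ((3 - n) * n ^ (15 + i)) := by gcongr
      _ ≤ _ := by
        rw [← Real.exp_add, Real.exp_le_exp]
        nlinarith
  linarith

lemma house_auxSum_le {K : Type*} [Field K] [NumberField K] {θ x y : 𝓞 K} {h : ℝ}
    (h0 : 0 ≤ h) (hθ : house (θ : K) ≤ Real.exp h) (hx : house (x : K) ≤ Real.exp h)
    (hy : house (y : K) ≤ Real.exp h) {k j b₀ L : ℕ} (P : Fin L × Fin L × Fin L → 𝓞 K)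
    (m₁ m₂ l : ℕ) :
    house ((auxSum θ x y k j b₀ P m₁ m₂ l : 𝓞 K) : K) ≤
      (∑ i, house (P i : K) * ((j * i.1 + i.2.2 * k : ℕ) : ℝ) ^ m₁ *
        ((j * i.2.1 + i.2.2 * b₀ : ℕ) : ℝ) ^ m₂) * Real.exp (2 * h * L * l) := by
  have : ((auxSum θ x y k j b₀ P m₁ m₂ l : 𝓞 K) : K) = ∑ i, (((j * i.1 + i.2.2 * k : ℕ) : K) ^ m₁ *
      ((j * i.2.1 + i.2.2 * b₀ : ℕ) : K) ^ m₂) * ((P i : K) * (auxMonomial θ x y i l : 𝓞 K)) := by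
    simp only [auxSum, map_sum, map_mul, map_pow, map_natCast]
    refine Finset.sum_congr rfl fun i _ ↦ ?_
    ring
  rw [this, Finset.sum_mul]
  refine (house_sum_le_sum_house _ _).trans (Finset.sum_le_sum fun i _ ↦ ?_)
  calc _ ≤ _ := house_natCast_mul_pow_le _ _ _ _ _
    _ ≤ ((j * i.1 + i.2.2 * k : ℕ) : ℝ) ^ m₁ * ((j * i.2.1 + i.2.2 * b₀ : ℕ) : ℝ) ^ m₂ *
        (house (P i : K) * Real.exp (2 * h * L * l)) := by
        gcongr
        refine (house_mul_le _ _).trans ?_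
        gcongr
        · exact house_nonneg _
        · exact house_auxMonomial_le h0 hθ hx hy i l
    _ = _ := by ring

lemma weight_le_exp {N j k a d : ℕ} (hN : 1000 ≤ N) (hexp : (N : ℝ) ^ 40 ≤ Real.exp N)
    (hj : (j : ℝ) ≤ Real.exp N) (hk : (k : ℝ) ≤ Real.exp N) (ha : a < N ^ 10) (hd : d < N ^ 10) :
    ((j * a + d * k : ℕ) : ℝ) ≤ Real.exp (2 * N) := by
  have hn : (1000 : ℝ) ≤ N := by exact_mod_cast hN
  have ha' : (a : ℝ) ≤ (N : ℝ) ^ 10 := by exact_mod_cast ha.le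
  have hd' : (d : ℝ) ≤ (N : ℝ) ^ 10 := by exact_mod_cast hd.le
  push_cast
  calc (j : ℝ) * a + d * k ≤ Real.exp N * (N : ℝ) ^ 10 + (N : ℝ) ^ 10 * Real.exp N := by gcongr
    _ = Real.exp N * (2 * (N : ℝ) ^ 10) := by ring
    _ ≤ Real.exp N * Real.exp N := by
      gcongr
      exact (mul_pow_le_pow_succ (by linarith) (by linarith) (by norm_num)).trans hexp
    _ = _ := by rw [← Real.exp_add]; ring_nf

/-- One extrapolation step: the auxiliary sums vanish at more integers, to a lower order. -/
theorem auxSum_eq_zero_of_vanishing {K : Type*} [Field K] [NumberField K] {N : ℕ}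
    (hN : 1000 ≤ N) (hd : 4 * Module.finrank ℚ K + 5 ≤ N) (hexp : (N : ℝ) ^ 40 ≤ Real.exp N)
    (φ : K →+* ℂ) {θ x y : 𝓞 K} {lθ lγ : ℂ} {k j b₀ : ℕ} (hy0 : y ≠ 0)
    (hθ : house (θ : K) ≤ Real.exp N) (hx : house (x : K) ≤ Real.exp N)
    (hy : house (y : K) ≤ Real.exp N) (hlθ : Complex.exp lθ = φ θ)
    (hlγ : Complex.exp lγ = φ x / φ y) (hlθ10 : ‖lθ‖ ≤ 10) (hlγ10 : ‖lγ‖ ≤ 10)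
    (hk : (k : ℝ) ≤ Real.exp N) (hj1 : 1 ≤ j) (hj : (j : ℝ) ≤ Real.exp N) (hb₀ : b₀ ≤ 1)
    (hΛ : ‖k * lθ + b₀ * lγ - 2 * Real.pi * Complex.I * j‖ ≤ Real.exp (-N ^ 40))
    {P : Fin (N ^ 10) × Fin (N ^ 10) × Fin (N ^ 10) → 𝓞 K}
    (hP : ∀ i, house (P i : K) ≤ Real.exp (N ^ 15)) {i : ℕ} (hi : i ≤ 16)
    (hvan : ∀ l < N ^ (3 + i), ∀ m₁ < (18 - i) * N ^ 13, ∀ m₂ < (18 - i) * N ^ 13,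
      auxSum θ x y k j b₀ P m₁ m₂ l = 0) :
    ∀ l < N ^ (4 + i), ∀ m₁ < (17 - i) * N ^ 13, ∀ m₂ < (17 - i) * N ^ 13,
      auxSum θ x y k j b₀ P m₁ m₂ l = 0 := by
  intro l hl m₁ hm₁ m₂ hm₂
  have hn : (1000 : ℝ) ≤ N := by exact_mod_cast hN
  have hn1 : (1 : ℝ) ≤ N := by linarith
  have hφy : φ y ≠ 0 := (map_ne_zero φ).mpr (by simpa using hy0)
  have hT : (17 - i) * N ^ 13 + N ^ 13 = (18 - i) * N ^ 13 := by
    rw [← Nat.succ_mul]; congr 1; omega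
  have hT18 : (18 - i) * N ^ 13 ≤ 18 * N ^ 13 := Nat.mul_le_mul_right _ (by omega)
  have hb₀' : (b₀ : ℝ) ≤ Real.exp N :=
    (by exact_mod_cast hb₀ : (b₀ : ℝ) ≤ 1).trans (Real.one_le_exp (by linarith))
  set u : Fin (N ^ 10) × Fin (N ^ 10) × Fin (N ^ 10) → ℕ := fun i ↦ j * i.1 + i.2.2 * k with hu
  set v : Fin (N ^ 10) × Fin (N ^ 10) × Fin (N ^ 10) → ℕ :=
    fun i ↦ j * i.2.1 + i.2.2 * b₀ with hv
  have hG : ∀ m₁ < (18 - i) * N ^ 13, ∀ m₂ < (18 - i) * N ^ 13,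
      ∑ i, house (P i : K) * (u i : ℝ) ^ m₁ * (v i : ℝ) ^ m₂ ≤ Real.exp (2 * N ^ 15) :=
    fun m₁ h₁ m₂ h₂ ↦ sum_weights_le hN hexp (fun _ ↦ house_nonneg _) hP
      (fun _ ↦ Nat.cast_nonneg _) (fun _ ↦ Nat.cast_nonneg _)
      (fun i ↦ weight_le_exp hN hexp hj hk i.1.2 i.2.2.2)
      (fun i ↦ weight_le_exp hN hexp hj hb₀' i.2.1.2 i.2.2.2) (by omega) (by omega)
  set Λ := k * lθ + b₀ * lγ - 2 * Real.pi * Complex.I * j with hΛdef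
  set ε := Real.exp (20 * (N ^ 10 : ℕ) * (N ^ (4 + i) : ℕ)) *
      (2 * ((N ^ 10 : ℕ) * (N ^ (4 + i) : ℕ) * ‖Λ‖)) with hε
  have hΛsmall : (N ^ 10 : ℕ) * (N ^ (4 + i) : ℕ) * ‖Λ‖ ≤ 1 := by
    have h1 : (N : ℝ) ^ 10 * (N : ℝ) ^ (4 + i) ≤ (N : ℝ) ^ 40 := by
      rw [← pow_add]
      exact pow_le_pow_right₀ hn1 (by omega)
    have h2 : (N : ℝ) ≤ (N : ℝ) ^ 40 := le_self_pow₀ hn1 (by norm_num)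
    calc _ ≤ Real.exp (N ^ 40) * Real.exp (-N ^ 40) := by
          push_cast
          gcongr
          exact (h1.trans hexp).trans (Real.exp_le_exp.mpr h2)
      _ = 1 := by rw [← Real.exp_add]; simp
  have hΛ1 : ‖Λ‖ ≤ 1 := hΛ.trans (Real.exp_le_one_iff.mpr (by
    have : (0 : ℝ) ≤ (N : ℝ) ^ 40 := by positivity
    linarith))
  have hdiv : ∀ z : ℂ, ‖z‖ ≤ 10 → ‖z / j‖ ≤ 10 := by
    intro z hz
    rw [norm_div, Complex.norm_natCast]
    exact (div_le_self (norm_nonneg _) (by exact_mod_cast hj1)).trans hz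
  have hsmall := norm_expSum_le_of_vanishing (p := fun i ↦ φ (P i))
    (u := fun i ↦ (u i : ℂ)) (v := fun i ↦ (v i : ℂ))
    (ω := fun i ↦ lθ / j * (u i : ℂ) + lγ / j * (v i : ℂ)) (s := lθ / j) (t := lγ / j)
    (a := fun i l ↦ φ θ ^ ((i.1 : ℕ) * l) * (φ x / φ y) ^ ((i.2.1 : ℕ) * l))
    (B := 28 * (N ^ 10 : ℕ)) (ε := ε) (G := Real.exp (2 * N ^ 15)) (S := N ^ (3 + i))
    (S' := N ^ (4 + i)) (T := (17 - i) * N ^ 13) (T' := N ^ 13) (fun _ ↦ rfl)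
    (hdiv _ hlθ10) (hdiv _ hlγ10)
    (fun i ↦ norm_frequency_le hj1 hlθ10 hlγ10 hΛ1 i.1.2.le i.2.1.2.le i.2.2.2.le)
    (Nat.pow_le_pow_right (by omega) (by omega)) (Nat.one_le_pow _ _ (by omega))
    (by positivity)
    (fun i l hl ↦ by
      rw [← hlθ, ← hlγ]
      exact norm_exp_frequency_sub_le hj1 hlθ10 hlγ10 hΛsmall i.1.2.le i.2.1.2.le
        i.2.2.2.le hl.le)
    (fun m₁ h₁ m₂ h₂ ↦ by
      refine le_trans (Finset.sum_le_sum fun i _ ↦ ?_) (hG m₁ (by omega) m₂ (by omega))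
      simp only [Complex.norm_natCast]
      gcongr
      exact norm_embedding_le_house _ _)
    (fun l hl m₁ h₁ m₂ h₂ ↦ by
      have h0 := map_auxSum φ hy0 (k := k) (j := j) (b₀ := b₀) (θ := θ) (x := x) P m₁ m₂ l
      rw [hvan l hl m₁ (by omega) m₂ (by omega)] at h0
      have h1 : φ ((0 : 𝓞 K) : K) = 0 := by simp
      rw [h1] at h0
      exact (mul_eq_zero.mp h0.symm).resolve_left (pow_ne_zero _ hφy))
    hl hm₁ hm₂
  have hlt := hsmall.trans_lt
    (extrapolation_bound_lt hN hd hexp hi (norm_nonneg Λ) hΛ hε)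
  by_contra hne
  have hl' : (l : ℝ) ≤ (N : ℝ) ^ (4 + i) := by exact_mod_cast hl.le
  set z := auxSum θ x y k j b₀ P m₁ m₂ l with hz
  set V := ∑ i, φ (P i) * (u i : ℂ) ^ m₁ * (v i : ℂ) ^ m₂ *
    (φ θ ^ ((i.1 : ℕ) * l) * (φ x / φ y) ^ ((i.2.1 : ℕ) * l)) with hV
  have hliou := one_le_norm_mul_house_pow φ hne
  have hX15 : (N : ℝ) ^ 15 ≤ (N : ℝ) ^ (15 + i) := pow_le_pow_right₀ hn1 (by omega)
  have hNl : (N : ℝ) * (N ^ 10 : ℕ) * l ≤ N ^ (15 + i) := by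
    push_cast
    calc _ ≤ (N : ℝ) * N ^ 10 * N ^ (4 + i) := by gcongr
      _ = _ := by ring
  have hhouse : house (z : K) ≤ Real.exp (4 * N ^ (15 + i)) := by
    calc _ ≤ _ := house_auxSum_le (by linarith) hθ hx hy P m₁ m₂ l
      _ ≤ Real.exp (2 * N ^ 15) * Real.exp (2 * N * (N ^ 10 : ℕ) * l) := by
        gcongr
        exact hG m₁ (by omega) m₂ (by omega)
      _ ≤ _ := by
        rw [← Real.exp_add, Real.exp_le_exp]
        linarith
  have hnorm : ‖φ z‖ ≤ Real.exp (N ^ (15 + i)) * ‖V‖ := by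
    rw [hz, map_auxSum φ hy0, norm_mul]
    gcongr
    rw [norm_pow]
    calc _ ≤ Real.exp N ^ (N ^ 10 * l) := by
          gcongr
          exact (norm_embedding_le_house (y : K) φ).trans hy
      _ ≤ _ := by
          rw [← Real.exp_nat_mul, Real.exp_le_exp]
          push_cast at hNl ⊢
          linarith
  have hd1 : 1 ≤ Module.finrank ℚ K := Module.finrank_pos
  have hfin : (1 : ℝ) ≤ Real.exp (4 * Module.finrank ℚ K * N ^ (15 + i)) * ‖V‖ := by
    calc (1 : ℝ) ≤ ‖φ z‖ * house (z : K) ^ (Module.finrank ℚ K - 1) := hliou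
      _ ≤ Real.exp (N ^ (15 + i)) * ‖V‖ *
          Real.exp (4 * N ^ (15 + i)) ^ (Module.finrank ℚ K - 1) := by
        have := house_nonneg (z : K)
        gcongr
      _ ≤ _ := by
        rw [← Real.exp_nat_mul, mul_right_comm, ← Real.exp_add, Nat.cast_sub hd1]
        gcongr
        have : (0 : ℝ) ≤ N ^ (15 + i) := by positivity
        push_cast
        linarith
  have : Real.exp (4 * Module.finrank ℚ K * N ^ (15 + i)) * ‖V‖ <
      Real.exp (4 * Module.finrank ℚ K * N ^ (15 + i)) *
        Real.exp (-(4 * Module.finrank ℚ K * N ^ (15 + i))) := by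
    gcongr
  rw [← Real.exp_add, add_neg_cancel, Real.exp_zero] at this
  linarith

lemma eventually_natCast_pow_le_exp (a : ℕ) :
    ∀ᶠ N : ℕ in Filter.atTop, (N : ℝ) ^ a ≤ Real.exp N := by
  have h := (Real.isLittleO_pow_exp_atTop (n := a)).bound one_pos
  filter_upwards [tendsto_natCast_atTop_atTop.eventually h] with N hN
  simpa using hN

/-- **Baker's theorem** in the shape needed here: a lower bound for `k lθ + b₀ lγ - 2πij`, where
`lθ` is a logarithm of `φ θ` and `lγ` is one of `φ x / φ y`. -/
theorem eventually_exp_neg_le_norm_linearForm (K : Type*) [Field K] [NumberField K] :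
    ∀ᶠ N : ℕ in Filter.atTop, ∀ (φ : K →+* ℂ) (θ x y : 𝓞 K) (lθ lγ : ℂ) (k j b₀ : ℕ), y ≠ 0 →
      house (θ : K) ≤ Real.exp N → house (x : K) ≤ Real.exp N → house (y : K) ≤ Real.exp N →
      Complex.exp lθ = φ θ → Complex.exp lγ = φ x / φ y → ‖lθ‖ ≤ 10 → ‖lγ‖ ≤ 10 →
      1 ≤ k → (k : ℝ) ≤ Real.exp N → 1 ≤ j → (j : ℝ) ≤ Real.exp N → b₀ ≤ 1 →
      (∀ b c b' c' : ℕ, b < N ^ 10 → c < N ^ 10 → b' < N ^ 10 → c' < N ^ 10 →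
        φ θ ^ b * (φ x / φ y) ^ c = φ θ ^ b' * (φ x / φ y) ^ c' → b = b' ∧ c = c') →
      Real.exp (-N ^ 40) ≤ ‖k * lθ + b₀ * lγ - 2 * Real.pi * Complex.I * j‖ := by
  obtain ⟨C, hC1, hC⟩ := exists_siegel_solution K
  filter_upwards [eventually_natCast_pow_le_exp 40, Filter.eventually_ge_atTop 1000,
    Filter.eventually_ge_atTop (4 * Module.finrank ℚ K + 5),
    Filter.eventually_ge_atTop ⌈C * C⌉₊] with N hexp hN hd hCN
  intro φ θ x y lθ lγ k j b₀ hy0 hθ hx hy hlθ hlγ hlθ10 hlγ10 hk1 hk hj1 hj hb₀ hinj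
  by_contra! hlt
  have hn : (1000 : ℝ) ≤ N := by exact_mod_cast hN
  have hn1 : (1 : ℝ) ≤ N := by linarith
  have hCN' : C * C ≤ N := Nat.ceil_le.mp hCN
  have hb₀' : (b₀ : ℝ) ≤ Real.exp N :=
    (by exact_mod_cast hb₀ : (b₀ : ℝ) ≤ 1).trans (Real.one_le_exp (by linarith))
  let a : Matrix (Fin (N ^ 3) × Fin (18 * N ^ 13) × Fin (18 * N ^ 13))
      (Fin (N ^ 10) × Fin (N ^ 10) × Fin (N ^ 10)) (𝓞 K) := fun e i ↦
    ((j * i.1 + i.2.2 * k : ℕ) : 𝓞 K) ^ (e.2.1 : ℕ) *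
      ((j * i.2.1 + i.2.2 * b₀ : ℕ) : 𝓞 K) ^ (e.2.2 : ℕ) * auxMonomial θ x y i e.1
  have ha : ∀ e i, house (a e i : K) ≤ Real.exp (74 * N ^ 14) := by
    intro e i
    have hpow : ∀ w : ℕ, (w : ℝ) ≤ Real.exp (2 * N) → ∀ m < 18 * N ^ 13,
        (w : ℝ) ^ m ≤ Real.exp (36 * N ^ 14) := by
      intro w hw m hm
      have hm' : (m : ℝ) ≤ 18 * N ^ 13 := by exact_mod_cast hm.le
      calc (w : ℝ) ^ m ≤ Real.exp (2 * N) ^ m := pow_le_pow_left₀ (Nat.cast_nonneg _) hw m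
        _ = Real.exp (m * (2 * N)) := (Real.exp_nat_mul _ _).symm
        _ ≤ Real.exp (18 * N ^ 13 * (2 * N)) := by gcongr
        _ = _ := by ring_nf
    have he1 : ((e.1 : ℕ) : ℝ) ≤ N ^ 3 := by exact_mod_cast e.1.2.le
    simp only [a, map_mul, map_pow, map_natCast]
    calc _ ≤ _ := house_natCast_mul_pow_le _ _ _ _ _
      _ ≤ Real.exp (36 * N ^ 14) * Real.exp (36 * N ^ 14) *
          Real.exp (2 * N * (N ^ 10 : ℕ) * (e.1 : ℕ)) := by
          gcongr
          · exact house_nonneg _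
          · exact hpow _ (weight_le_exp hN hexp hj hk i.1.2 i.2.2.2) _ e.2.1.2
          · exact hpow _ (weight_le_exp hN hexp hj hb₀' i.2.1.2 i.2.2.2) _ e.2.2.2
          · exact house_auxMonomial_le (by linarith) hθ hx hy i _
      _ ≤ _ := by
          rw [← Real.exp_add, ← Real.exp_add, Real.exp_le_exp]
          push_cast
          have : 2 * (N : ℝ) * N ^ 10 * (e.1 : ℕ) ≤ 2 * N * N ^ 10 * N ^ 3 := by gcongr
          linarith
  obtain ⟨P, hP0, hP1, hP2⟩ := hC _ _ a (Real.exp (74 * N ^ 14)) (Real.one_le_exp (by positivity))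
    ha (by simp only [Fintype.card_prod, Fintype.card_fin]; positivity) (by
      simp only [Fintype.card_prod, Fintype.card_fin]
      calc 2 * (N ^ 3 * (18 * N ^ 13 * (18 * N ^ 13))) = 648 * N ^ 29 := by ring
        _ ≤ N * N ^ 29 := Nat.mul_le_mul_right _ (by omega)
        _ = _ := by ring)
  have hP : ∀ i, house (P i : K) ≤ Real.exp (N ^ 15) := by
    intro i
    refine (hP2 i).trans ?_
    simp only [Fintype.card_prod, Fintype.card_fin]
    push_cast
    have h30 : (N : ℝ) ^ 31 ≤ Real.exp N :=
      (pow_le_pow_right₀ hn1 (by norm_num)).trans hexp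
    calc _ = C * C * (N : ℝ) ^ 30 * Real.exp (74 * N ^ 14) := by ring
      _ ≤ N * (N : ℝ) ^ 30 * Real.exp (74 * N ^ 14) := by gcongr
      _ = (N : ℝ) ^ 31 * Real.exp (74 * N ^ 14) := by ring
      _ ≤ Real.exp N * Real.exp (74 * N ^ 14) := by gcongr
      _ ≤ _ := by
        rw [← Real.exp_add, Real.exp_le_exp]
        have h1 := mul_pow_le_pow_succ (c := 75) (a := 14) (b := 15) (by linarith) hn1 le_rfl
        have h2 : (N : ℝ) ≤ N ^ 14 := le_self_pow₀ hn1 (by norm_num)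
        linarith
  have hvan : ∀ i ≤ 17, ∀ l < N ^ (3 + i), ∀ m₁ < (18 - i) * N ^ 13, ∀ m₂ < (18 - i) * N ^ 13,
      auxSum θ x y k j b₀ P m₁ m₂ l = 0 := by
    intro i
    induction i with
    | zero =>
      intro _ l hl m₁ hm₁ m₂ hm₂
      have h := congrFun hP1 (⟨l, hl⟩, ⟨m₁, hm₁⟩, ⟨m₂, hm₂⟩)
      rw [Pi.zero_apply] at h
      rw [← h]
      simp only [auxSum, Matrix.mulVec, dotProduct, a]
      exact Finset.sum_congr rfl fun _ _ ↦ by ring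
    | succ i ih =>
      intro hi
      have := auxSum_eq_zero_of_vanishing hN hd hexp φ hy0 hθ hx hy hlθ hlγ hlθ10 hlγ10 hk hj1
        hj hb₀ hlt.le hP (by omega : i ≤ 16) (ih (by omega))
      rw [show 3 + (i + 1) = 4 + i by ring, show 18 - (i + 1) = 17 - i by omega]
      exact this
  refine hP0 (eq_zero_of_auxSum_eq_zero φ hy0 hk1 hinj (j := j) (b := b₀)
    (S := N ^ 20) (T := N ^ 13)
    (by rw [← pow_add]) (Nat.pow_le_pow_right (by omega) (by norm_num)) ?_)
  simpa using hvan 17 le_rfl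

lemma house_coe_natCast {K : Type*} [Field K] [NumberField K] (n : ℕ) :
    house (((n : 𝓞 K) : K)) = n := by
  have := house_intCast (K := K) n
  simpa using this

lemma norm_pow_sub_one_le_nat_mul {z : ℂ} (hz : ‖z‖ = 1) (e : ℕ) :
    ‖z ^ e - 1‖ ≤ e * ‖z - 1‖ := by
  induction e with
  | zero => simp
  | succ e ih =>
    have h : z ^ (e + 1) - 1 = z ^ e * (z - 1) + (z ^ e - 1) := by ring
    calc _ ≤ ‖z ^ e * (z - 1)‖ + ‖z ^ e - 1‖ := by rw [h]; exact norm_add_le _ _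
      _ ≤ ‖z - 1‖ + e * ‖z - 1‖ := by
        rw [norm_mul, norm_pow, hz, one_pow, one_mul]
        gcongr
      _ = _ := by push_cast; ring

lemma exists_nat_norm_sub_le {ϑ g : ℝ} {k : ℕ} (hϑ0 : 0 < ϑ) (hϑ : ϑ ≤ 2 * Real.pi)
    (hg : |g| ≤ Real.pi) (hk : 10 ≤ k * ϑ) {z : ℂ} (hz : Complex.exp ((k * ϑ + g) * Complex.I) = z)
    (hz1 : ‖z - 1‖ ≤ 1 / 2) :
    ∃ j : ℕ, 1 ≤ j ∧ j ≤ k + 1 ∧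
      ‖(k * ϑ + g) * Complex.I - 2 * Real.pi * Complex.I * j‖ ≤ 2 * ‖z - 1‖ := by
  have hπ := Real.pi_gt_three
  have hπ4 := Real.pi_le_four
  have hlog := Complex.norm_log_one_add_half_le_self hz1
  rw [add_sub_cancel] at hlog
  have hz0 : z ≠ 0 := by rw [← hz]; exact Complex.exp_ne_zero _
  obtain ⟨n, hn⟩ : ∃ n : ℤ, (k * ϑ + g) * Complex.I =
      Complex.log z + n * (2 * Real.pi * Complex.I) := by
    rw [← Complex.exp_eq_exp_iff_exists_int, hz, Complex.exp_log hz0]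
  have him : k * ϑ + g = (Complex.log z).im + n * (2 * Real.pi) := by
    have := congrArg Complex.im hn
    simpa using this
  have habs : |(Complex.log z).im| ≤ 3 / 4 :=
    (Complex.abs_im_le_norm _).trans (hlog.trans (by linarith))
  have h1 := abs_le.mp habs
  have h2 := abs_le.mp hg
  have hn0 : 0 < n := by
    by_contra! h
    have : (n : ℝ) ≤ 0 := by exact_mod_cast h
    nlinarith
  have hnk : n ≤ k + 1 := by
    by_contra! h
    have h3 : (k : ℝ) + 2 ≤ n := by exact_mod_cast h
    have : (k : ℝ) * ϑ ≤ k * (2 * Real.pi) := by gcongr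
    nlinarith
  lift n to ℕ using hn0.le
  refine ⟨n, by omega, by omega, ?_⟩
  have : (k * ϑ + g) * Complex.I - 2 * Real.pi * Complex.I * n = Complex.log z := by
    rw [hn]; push_cast; ring
  rw [this]
  linarith [norm_nonneg (z - 1)]

set_option maxHeartbeats 400000 in
/-- Powers of an algebraic integer on the unit circle, not a root of unity, stay away from any
algebraic number on the unit circle of moderate height. -/
theorem eventually_exp_neg_le_norm_pow_mul_sub_one {K : Type*} [Field K] [NumberField K]
    (φ : K →+* ℂ) {θ : 𝓞 K} (hθ1 : ‖φ θ‖ = 1) (hθ : ∀ n : ℕ, 1 ≤ n → θ ^ n ≠ 1) :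
    ∀ᶠ N : ℕ in Filter.atTop, ∀ (x y : 𝓞 K) (k : ℕ), y ≠ 0 →
      house (x : K) ≤ Real.exp N → house (y : K) ≤ Real.exp N → ‖φ x‖ = ‖φ y‖ →
      N ^ 11 ≤ k → (k : ℝ) ≤ Real.exp N →
      Real.exp (-N ^ 41) ≤ ‖φ θ ^ k * (φ x / φ y) - 1‖ := by
  have hπ := Real.pi_gt_three
  have hπ4 := Real.pi_lt_d2
  have hθ0 : φ θ ≠ 0 := norm_pos_iff.mp (by rw [hθ1]; exact one_pos)
  have hθpow : ∀ n : ℕ, 1 ≤ n → φ θ ^ n ≠ 1 := by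
    intro n hn h
    refine hθ n hn ?_
    have h2 : φ (θ ^ n : 𝓞 K) = φ (1 : 𝓞 K) := by simpa using h
    exact_mod_cast φ.injective h2
  have hθinj : ∀ b b' : ℕ, φ θ ^ b = φ θ ^ b' → b = b' := by
    have key : ∀ b b' : ℕ, b ≤ b' → φ θ ^ b = φ θ ^ b' → b = b' := by
      intro b b' hb h
      by_contra hne
      refine hθpow (b' - b) (by omega) ?_
      rw [pow_sub₀ _ hθ0 hb, ← h, mul_inv_cancel₀ (pow_ne_zero _ hθ0)]
    intro b b' h
    rcases le_total b b' with hb | hb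
    · exact key b b' hb h
    · exact (key b' b hb h.symm).symm
  obtain ⟨ϑ, hϑ0, hϑ, hϑθ⟩ : ∃ ϑ : ℝ, 0 < ϑ ∧ ϑ ≤ 2 * Real.pi ∧
      Complex.exp (ϑ * Complex.I) = φ θ := by
    have hexp : Complex.exp ((φ θ).arg * Complex.I) = φ θ := by
      have := Complex.norm_mul_exp_arg_mul_I (φ θ)
      rwa [hθ1, Complex.ofReal_one, one_mul] at this
    rcases lt_or_ge 0 (φ θ).arg with h | h
    · exact ⟨_, h, by linarith [Complex.arg_le_pi (φ θ)], hexp⟩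
    · refine ⟨(φ θ).arg + 2 * Real.pi, by linarith [Complex.neg_pi_lt_arg (φ θ)], by linarith, ?_⟩
      push_cast
      rw [add_mul, Complex.exp_add, Complex.exp_two_pi_mul_I, mul_one, hexp]
  have hBaker := (Filter.tendsto_id.const_mul_atTop' (r := 2) (by norm_num)).eventually
    (eventually_exp_neg_le_norm_linearForm K)
  have hhouse : ∀ᶠ N : ℕ in Filter.atTop, house (θ : K) ≤ Real.exp N :=
    (Real.tendsto_exp_atTop.comp tendsto_natCast_atTop_atTop).eventually_ge_atTop _
  filter_upwards [hBaker, hhouse, eventually_natCast_pow_le_exp 12,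
    Filter.eventually_ge_atTop (2 ^ 41),
    Filter.eventually_ge_atTop (1025 + ⌈10 / ϑ⌉₊)] with N hB hNθ hexp hN hN10
  intro x y k hy hxh hyh hxy hkN hk
  simp only [id] at hB
  have hn : (2 : ℝ) ^ 41 ≤ N := by exact_mod_cast hN
  have hn1 : (1 : ℝ) ≤ N := le_trans (by norm_num) hn
  have hφy : φ y ≠ 0 := (map_ne_zero φ).mpr (by simpa using hy)
  set γ := φ x / φ y with hγ
  have hγ1 : ‖γ‖ = 1 := by
    rw [hγ, norm_div, hxy, div_self (norm_ne_zero_iff.mpr hφy)]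
  have hγ0 : γ ≠ 0 := norm_pos_iff.mp (by rw [hγ1]; exact one_pos)
  set z := φ θ ^ k * γ with hz
  have hz1 : ‖z‖ = 1 := by rw [hz, norm_mul, norm_pow, hθ1, hγ1]; simp
  by_contra! hlt
  have hexp2 : Real.exp N ≤ Real.exp (2 * N) := Real.exp_le_exp.mpr (by linarith)
  have h2N : ((2 * N : ℕ) : ℝ) = 2 * N := by push_cast; rfl
  have hkϑ : (1025 : ℝ) * N ^ 10 + 10 / ϑ ≤ k := by
    have h1 : (10 : ℝ) / ϑ ≤ ⌈10 / ϑ⌉₊ := Nat.le_ceil _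
    have h2 : (1025 : ℝ) + ⌈10 / ϑ⌉₊ ≤ N := by exact_mod_cast hN10
    have h3 : (N : ℝ) ^ 11 ≤ k := by exact_mod_cast hkN
    have h4 : (1 : ℝ) ≤ N ^ 10 := one_le_pow₀ hn1
    have h5 : 0 < 10 / ϑ := by positivity
    nlinarith
  have hM : (((2 * N) ^ 10 : ℕ) : ℝ) = 1024 * N ^ 10 := by push_cast; ring
  have hNexp : 2 ^ 12 * (N : ℝ) ^ 10 ≤ Real.exp N :=
    (mul_pow_le_pow_succ (le_trans (by norm_num) hn) hn1 (by norm_num)).trans hexp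
  -- a small linear form contradicts the lower bound
  have hsmall : ((2 * N) ^ 10 : ℕ) * ‖z - 1‖ < Real.exp (-(2 * N) ^ 40) / 2 := by
    have h1 : (2 * N : ℝ) ^ 40 + N ≤ N ^ 41 := by
      have h2 : (N : ℝ) ≤ N ^ 40 := le_self_pow₀ hn1 (by norm_num)
      have h3 : (2 ^ 40 + 1) * (N : ℝ) ^ 40 ≤ N ^ 41 :=
        mul_pow_le_pow_succ (le_trans (by norm_num) hn) hn1 le_rfl
      rw [mul_pow]
      linarith
    have h4 : (2 : ℝ) * ((2 * N) ^ 10 : ℕ) ≤ Real.exp N := by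
      rw [hM]
      have : (0 : ℝ) ≤ N ^ 10 := by positivity
      linarith
    have h5 : (2 : ℝ) * ((2 * N) ^ 10 : ℕ) * ‖z - 1‖ < Real.exp N * Real.exp (-N ^ 41) := by
      have : (0 : ℝ) < ((2 * N) ^ 10 : ℕ) := by rw [hM]; positivity
      exact mul_lt_mul' h4 hlt (norm_nonneg _) (Real.exp_pos _)
    have h6 : Real.exp N * Real.exp (-N ^ 41) ≤ Real.exp (-(2 * N) ^ 40) := by
      rw [← Real.exp_add, Real.exp_le_exp]
      linarith
    linarith
  have hle1 : Real.exp (-(2 * N) ^ 40) ≤ 1 := Real.exp_le_one_iff.mpr (by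
    have : (0 : ℝ) ≤ (2 * N) ^ 40 := by positivity
    linarith)
  have hM1 : (1 : ℝ) ≤ ((2 * N) ^ 10 : ℕ) := by
    rw [hM]
    have : (1 : ℝ) ≤ N ^ 10 := one_le_pow₀ hn1
    linarith
  have hlθ10 : ‖(ϑ * Complex.I : ℂ)‖ ≤ 10 := by
    simp [abs_of_pos hϑ0]
    linarith
  by_cases hinj : ∀ b c b' c' : ℕ, b < (2 * N) ^ 10 → c < (2 * N) ^ 10 → b' < (2 * N) ^ 10 →
      c' < (2 * N) ^ 10 → φ θ ^ b * γ ^ c = φ θ ^ b' * γ ^ c' → b = b' ∧ c = c'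
  · have hexpγ : Complex.exp (γ.arg * Complex.I) = γ := by
      have := Complex.norm_mul_exp_arg_mul_I γ
      rwa [hγ1, Complex.ofReal_one, one_mul] at this
    have hz' : Complex.exp ((k * ϑ + γ.arg) * Complex.I) = z := by
      rw [add_mul, Complex.exp_add, hexpγ, mul_assoc, Complex.exp_nat_mul, hϑθ]
    have hzs : ‖z - 1‖ < Real.exp (-(2 * N) ^ 40) / 2 :=
      lt_of_le_of_lt (le_mul_of_one_le_left (norm_nonneg _) hM1) hsmall
    obtain ⟨j, hj1, hjk, hj⟩ := exists_nat_norm_sub_le hϑ0 hϑ (Complex.abs_arg_le_pi γ)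
      (by
        have : 10 / ϑ ≤ k := by linarith [show (0 : ℝ) ≤ 1025 * N ^ 10 by positivity]
        rwa [div_le_iff₀ hϑ0] at this) hz' (by linarith)
    have hjk' : (j : ℝ) ≤ k + 1 := by exact_mod_cast hjk
    have := hB φ θ x y (ϑ * Complex.I) (γ.arg * Complex.I) k j 1 hy
      (by rw [h2N]; exact hNθ.trans hexp2) (by rw [h2N]; exact hxh.trans hexp2)
      (by rw [h2N]; exact hyh.trans hexp2) hϑθ hexpγ hlθ10
      (by
        have := Complex.abs_arg_le_pi γ
        simp
        linarith)
      (le_trans (Nat.one_le_pow _ _ (by omega)) hkN) (by rw [h2N]; exact hk.trans hexp2) hj1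
      (by
        rw [h2N, two_mul, Real.exp_add]
        have h2 : (2 : ℝ) ≤ Real.exp N := by linarith [Real.add_one_le_exp (N : ℝ)]
        nlinarith)
      le_rfl hinj
    rw [h2N] at this
    have heq : (k : ℂ) * (ϑ * Complex.I) + (1 : ℕ) * (γ.arg * Complex.I) -
        2 * Real.pi * Complex.I * j =
        (k * ϑ + γ.arg) * Complex.I - 2 * Real.pi * Complex.I * j := by
      push_cast; ring
    rw [heq] at this
    linarith
  · obtain ⟨b, e, b', hb, he, hb', he1, hrel⟩ : ∃ b e b' : ℕ, b < (2 * N) ^ 10 ∧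
        e < (2 * N) ^ 10 ∧ b' < (2 * N) ^ 10 ∧ 1 ≤ e ∧ φ θ ^ b * γ ^ e = φ θ ^ b' := by
      have key : ∀ b c b' c' : ℕ, b < (2 * N) ^ 10 → c < (2 * N) ^ 10 → b' < (2 * N) ^ 10 →
          c' < c → φ θ ^ b * γ ^ c = φ θ ^ b' * γ ^ c' → ∃ b e b' : ℕ, b < (2 * N) ^ 10 ∧
          e < (2 * N) ^ 10 ∧ b' < (2 * N) ^ 10 ∧ 1 ≤ e ∧ φ θ ^ b * γ ^ e = φ θ ^ b' := by
        intro b c b' c' hb hc hb' hcc h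
        refine ⟨b, c - c', b', hb, by omega, hb', by omega, ?_⟩
        refine mul_right_cancel₀ (pow_ne_zero c' hγ0) ?_
        rw [← h, mul_assoc, ← pow_add, Nat.sub_add_cancel hcc.le]
      push Not at hinj
      obtain ⟨b, c, b', c', hb, hc, hb', hc', h, hne⟩ := hinj
      rcases lt_trichotomy c c' with hcc | rfl | hcc
      · exact key b' c' b c hb' hc' hb hcc h.symm
      · exact absurd rfl (hne (hθinj _ _ (mul_right_cancel₀ (pow_ne_zero _ hγ0) h)))
      · exact key b c b' c' hb hc hb' hcc h
    have hkM : (2 * N) ^ 10 ≤ k := by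
      have : (((2 * N) ^ 10 : ℕ) : ℝ) ≤ k := by
        rw [hM]
        have : 0 < 10 / ϑ := by positivity
        linarith [show (0 : ℝ) ≤ N ^ 10 by positivity]
      exact_mod_cast this
    have hke : k ≤ k * e := Nat.le_mul_of_pos_right _ he1
    obtain ⟨k', hk'⟩ : ∃ k', k' + b = k * e + b' := ⟨k * e + b' - b, by omega⟩
    have hzk' : z ^ e = φ θ ^ k' := by
      refine mul_right_cancel₀ (pow_ne_zero b hθ0) ?_
      rw [← pow_add, hk', hz, mul_pow, ← pow_mul, pow_add, ← hrel]
      ring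
    have hze : ‖φ θ ^ k' - 1‖ < Real.exp (-(2 * N) ^ 40) / 2 := by
      rw [← hzk']
      refine lt_of_le_of_lt (norm_pow_sub_one_le_nat_mul hz1 e) (lt_of_le_of_lt ?_ hsmall)
      have : (e : ℝ) ≤ ((2 * N) ^ 10 : ℕ) := by exact_mod_cast he.le
      gcongr
    have hk'k : (k : ℝ) - 1024 * N ^ 10 ≤ k' := by
      have h1 : (k : ℝ) ≤ k' + b := by exact_mod_cast (by omega : k ≤ k' + b)
      have h2 : (b : ℝ) ≤ ((2 * N) ^ 10 : ℕ) := by exact_mod_cast hb.le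
      linarith
    have hk'10 : 10 ≤ k' * ϑ := by
      have : 10 / ϑ ≤ k' := by linarith [show (0 : ℝ) ≤ N ^ 10 by positivity]
      rwa [div_le_iff₀ hϑ0] at this
    have hk'exp : (k' : ℝ) + 1 ≤ Real.exp (2 * N) := by
      have h1 : (k' : ℝ) ≤ k * e + b' := by exact_mod_cast (by omega : k' ≤ k * e + b')
      have h2 : (b' : ℝ) ≤ ((2 * N) ^ 10 : ℕ) := by exact_mod_cast hb'.le
      have h3 : (e : ℝ) ≤ ((2 * N) ^ 10 : ℕ) := by exact_mod_cast he.le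
      have h4 : (k : ℝ) * e ≤ Real.exp N * ((2 * N) ^ 10 : ℕ) := by gcongr
      have h5 : (1 : ℝ) ≤ Real.exp N := Real.one_le_exp (by linarith)
      have h6 : Real.exp N * (2 ^ 12 * (N : ℝ) ^ 10) ≤ Real.exp N * Real.exp N := by gcongr
      rw [hM] at h2 h4 hM1
      have h7 : 1024 * (N : ℝ) ^ 10 ≤ Real.exp N * (1024 * N ^ 10) :=
        le_mul_of_one_le_left (by linarith) h5
      rw [two_mul, Real.exp_add]
      linarith
    have hz' : Complex.exp ((k' * ϑ + (0 : ℝ)) * Complex.I) = φ θ ^ k' := by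
      rw [Complex.ofReal_zero, add_zero, mul_assoc, Complex.exp_nat_mul, hϑθ]
    obtain ⟨j, hj1, hjk, hj⟩ := exists_nat_norm_sub_le hϑ0 hϑ (by simp; linarith) hk'10 hz'
      (by linarith)
    have hjk' : (j : ℝ) ≤ k' + 1 := by exact_mod_cast hjk
    have h2e : (2 : ℝ) ≤ Real.exp (2 * N) := by linarith [Real.add_one_le_exp (2 * N : ℝ)]
    have hlog2 : ‖((Real.log 2 : ℝ) : ℂ)‖ ≤ 10 := by
      rw [Complex.norm_real, Real.norm_eq_abs, abs_of_pos (Real.log_pos (by norm_num))]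
      linarith [Real.log_two_lt_d9]
    have hφ2 : φ ((2 : ℕ) : 𝓞 K) / φ (1 : 𝓞 K) = 2 := by
      have hφn : ∀ n : ℕ, φ (n : 𝓞 K) = n := fun n ↦ by simp
      rw [hφn]
      simp
    have := hB φ θ ((2 : ℕ) : 𝓞 K) 1 (ϑ * Complex.I) (Real.log 2 : ℝ) k' j 0 one_ne_zero
      (by rw [h2N]; exact hNθ.trans hexp2)
      (by
        rw [house_coe_natCast, h2N]
        exact_mod_cast h2e)
      (by
        have := house_coe_natCast (K := K) 1
        simp only [Nat.cast_one] at this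
        rw [this, h2N]
        linarith) hϑθ
      (by
        rw [← Complex.ofReal_exp, Real.exp_log (by norm_num), hφ2]
        simp)
      hlθ10 hlog2
      (by
        by_contra! h
        have : k' = 0 := by omega
        rw [this] at hk'10
        norm_num at hk'10)
      (by rw [h2N]; linarith) hj1 (by rw [h2N]; linarith) (by norm_num)
      (by
        intro b c b' c' _ _ _ _ h
        rw [hφ2] at h
        have hc : c = c' := by
          have := congrArg norm h
          simp only [norm_mul, norm_pow, hθ1, one_pow, one_mul, Complex.norm_ofNat] at this
          exact pow_right_injective₀ (by norm_num) (by norm_num) this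
        subst hc
        exact ⟨hθinj _ _ (mul_right_cancel₀ (pow_ne_zero _ two_ne_zero) h), rfl⟩)
    rw [h2N] at this
    have heq : (k' : ℂ) * (ϑ * Complex.I) + (0 : ℕ) * (Real.log 2 : ℝ) -
        2 * Real.pi * Complex.I * j =
        (k' * ϑ + (0 : ℝ)) * Complex.I - 2 * Real.pi * Complex.I * j := by
      push_cast; ring
    rw [heq] at this
    linarith

lemma tendsto_ceil_log_atTop :
    Filter.Tendsto (fun k : ℕ ↦ ⌈Real.log k⌉₊) Filter.atTop Filter.atTop :=
  tendsto_nat_ceil_atTop.comp (Real.tendsto_log_atTop.comp tendsto_natCast_atTop_atTop)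

lemma eventually_ceil_log_pow_le (a : ℕ) :
    ∀ᶠ k : ℕ in Filter.atTop, ⌈Real.log k⌉₊ ^ a ≤ k ∧ (k : ℝ) ≤ Real.exp ⌈Real.log k⌉₊ := by
  filter_upwards [tendsto_ceil_log_atTop.eventually (eventually_natCast_pow_le_exp (a + 1)),
    tendsto_ceil_log_atTop.eventually (Filter.eventually_ge_atTop 3),
    Filter.eventually_ge_atTop 1] with k hexp h3 hk
  have hk0 : (0 : ℝ) < k := by exact_mod_cast hk
  have h3' : (3 : ℝ) ≤ (⌈Real.log k⌉₊ : ℝ) := by exact_mod_cast h3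
  refine ⟨?_, ?_⟩
  · set n := ⌈Real.log k⌉₊
    have hn : (n : ℝ) < Real.log k + 1 := Nat.ceil_lt_add_one (Real.log_natCast_nonneg k)
    have h1 : Real.exp n ≤ k * n := by
      calc Real.exp n ≤ Real.exp (Real.log k + 1) := Real.exp_le_exp.mpr hn.le
        _ = k * Real.exp 1 := by rw [Real.exp_add, Real.exp_log hk0]
        _ ≤ k * n := by
          gcongr
          linarith [Real.exp_one_lt_d9]
    have h2 : (n : ℝ) ^ a * n ≤ k * n := by
      rw [← pow_succ]; exact hexp.trans h1
    exact_mod_cast le_of_mul_le_mul_right h2 (by linarith)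
  · calc (k : ℝ) = Real.exp (Real.log k) := (Real.exp_log hk0).symm
      _ ≤ _ := Real.exp_le_exp.mpr (Nat.le_ceil _)

lemma house_le_of_forall_norm_le {K : Type*} [Field K] [NumberField K] {z : K} {B : ℝ}
    (hB : 0 ≤ B) (h : ∀ ψ : K →+* ℂ, ‖ψ z‖ ≤ B) : house z ≤ B :=
  (pi_norm_le_iff_of_nonneg hB).2 h

/-- `eventually_exp_neg_le_norm_pow_mul_sub_one` for elements of the field which are integral. -/
lemma eventually_exp_neg_le_norm_one_add {K : Type*} [Field K] [NumberField K] (φ : K →+* ℂ)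
    {τ : K ≃ₐ[ℚ] K} (hτ : ∀ x, φ (τ x) = starRingEnd ℂ (φ x)) {θ : K} (hθi : IsIntegral ℤ θ)
    (hθ1 : ‖φ θ‖ = 1) (hθ : ∀ n : ℕ, 1 ≤ n → θ ^ n ≠ 1) :
    ∀ᶠ N : ℕ in Filter.atTop, ∀ (w : K) (k : ℕ), IsIntegral ℤ w → w ≠ 0 →
      (∀ ψ : K →+* ℂ, ‖ψ w‖ ≤ Real.exp N) → N ^ 11 ≤ k → (k : ℝ) ≤ Real.exp N →
      Real.exp (-N ^ 41) ≤ ‖1 + φ θ ^ k * (φ (τ w) / φ w)‖ := by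
  obtain ⟨θ, rfl⟩ : ∃ η : 𝓞 K, (η : K) = θ := ⟨⟨θ, hθi⟩, rfl⟩
  have h := eventually_exp_neg_le_norm_pow_mul_sub_one φ (θ := θ) hθ1 (fun n hn h ↦
    hθ n hn (congrArg Subtype.val h))
  filter_upwards [h] with N hN w k hw hw0 hwN hkN hk
  obtain ⟨y, rfl⟩ : ∃ y : 𝓞 K, (y : K) = w := ⟨⟨w, hw⟩, rfl⟩
  obtain ⟨x, hx⟩ : ∃ x : 𝓞 K, (x : K) = -τ y :=
    ⟨⟨-τ y, (hw.map (τ : K →+* K).toIntAlgHom).neg⟩, rfl⟩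
  have := hN x y k (fun h ↦ hw0 (congrArg Subtype.val h))
    (house_le_of_forall_norm_le (Real.exp_pos _).le fun ψ ↦ by
      rw [hx, map_neg, norm_neg]
      exact hwN (ψ.comp (τ : K →+* K)))
    (house_le_of_forall_norm_le (Real.exp_pos _).le hwN)
    (by rw [hx, map_neg, norm_neg, hτ, RCLike.norm_conj]) hkN hk
  rw [hx, map_neg, ← norm_neg] at this
  rwa [show 1 + φ θ ^ k * (φ (τ y) / φ y) = -(φ θ ^ k * (-φ (τ y) / φ y) - 1) by ring]

section

open ComplexConjugate

variable {A e c₁ c₂ c₃ : ℂ} {l k : ℕ}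

lemma norm_one_add_le_of_re_add_eq_zero (hA : conj A = A) (hAe : A * e * conj e = 1)
    (he : ‖e‖ < 1) (hc : c₁ ≠ 0)
    (h : (c₁ * A ^ l * (A * e) ^ k).re + (c₂ * e ^ l * (e * conj e) ^ k).re +
      (c₃ * conj e ^ l * (conj e * A) ^ k).re = 0) :
    ‖1 + (conj e * conj e * A) ^ k * (conj c₁ / c₁)‖ ≤
      2 * (‖c₂‖ + ‖c₃‖) / ‖c₁‖ * ‖e‖ ^ l := by
  have he0 : e ≠ 0 := by rintro rfl; simp at hAe
  have hr : 0 < ‖e‖ := norm_pos_iff.2 he0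
  have hAn : ‖A‖ * (‖e‖ * ‖e‖) = 1 := by
    have := congrArg norm hAe
    rwa [norm_mul, norm_mul, RCLike.norm_conj, norm_one, mul_assoc] at this
  have hA0 : A ≠ 0 := by rintro rfl; simp at hAe
  have hq : (A * e) ^ k * (conj e * conj e * A) ^ k = (A * conj e) ^ k := by
    rw [← mul_pow]
    congr 1
    linear_combination (A * conj e) * hAe
  have hX : (c₁ * A ^ l * (A * e) ^ k) * (1 + (conj e * conj e * A) ^ k * (conj c₁ / c₁)) =
      c₁ * A ^ l * (A * e) ^ k + conj (c₁ * A ^ l * (A * e) ^ k) := by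
    simp only [map_mul, map_pow, hA]
    rw [← hq]
    field_simp
  have hre : ∀ z : ℂ, z + conj z = (2 * z.re : ℝ) := Complex.add_conj
  have hnorm : ‖c₁‖ * ‖A‖ ^ l * (‖A‖ * ‖e‖) ^ k *
      ‖1 + (conj e * conj e * A) ^ k * (conj c₁ / c₁)‖ ≤
      2 * (‖c₂‖ * ‖e‖ ^ l * (‖e‖ * ‖e‖) ^ k + ‖c₃‖ * ‖e‖ ^ l * (‖e‖ * ‖A‖) ^ k) := by
    have := congrArg norm hX
    rw [hre, norm_mul, norm_mul, norm_mul, norm_pow, norm_pow, norm_mul, Complex.norm_real] at this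
    rw [this, Real.norm_eq_abs]
    have h2 := Complex.abs_re_le_norm (c₂ * e ^ l * (e * conj e) ^ k)
    have h3 := Complex.abs_re_le_norm (c₃ * conj e ^ l * (conj e * A) ^ k)
    simp only [norm_mul, norm_pow, RCLike.norm_conj] at h2 h3
    rw [abs_le] at h2 h3 ⊢
    constructor <;> linarith
  have h1 : ‖A‖ ^ l * (‖A‖ * ‖e‖) ^ k * (‖e‖ ^ (2 * l + k)) = 1 := by
    calc _ = (‖A‖ * (‖e‖ * ‖e‖)) ^ l * (‖A‖ * (‖e‖ * ‖e‖)) ^ k := by ring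
      _ = 1 := by rw [hAn]; simp
  have h2 : (‖e‖ * ‖A‖) ^ k * ‖e‖ ^ k = 1 := by
    rw [← mul_pow, show ‖e‖ * ‖A‖ * ‖e‖ = 1 by linarith, one_pow]
  have hc' : 0 < ‖c₁‖ := norm_pos_iff.2 hc
  rw [div_mul_eq_mul_div, le_div_iff₀ hc']
  calc ‖1 + (conj e * conj e * A) ^ k * (conj c₁ / c₁)‖ * ‖c₁‖
      = (‖c₁‖ * ‖A‖ ^ l * (‖A‖ * ‖e‖) ^ k *
        ‖1 + (conj e * conj e * A) ^ k * (conj c₁ / c₁)‖) * ‖e‖ ^ (2 * l + k) := by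
          linear_combination (-‖1 + (conj e * conj e * A) ^ k * (conj c₁ / c₁)‖ * ‖c₁‖) * h1
    _ ≤ (2 * (‖c₂‖ * ‖e‖ ^ l * (‖e‖ * ‖e‖) ^ k + ‖c₃‖ * ‖e‖ ^ l * (‖e‖ * ‖A‖) ^ k)) *
        ‖e‖ ^ (2 * l + k) := by gcongr
    _ = 2 * (‖c₂‖ * ‖e‖ ^ (3 * k + 2 * l) + ‖c₃‖ * ((‖e‖ * ‖A‖) ^ k * ‖e‖ ^ k) * ‖e‖ ^ (2 * l)) *
        ‖e‖ ^ l := by ring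
    _ ≤ 2 * (‖c₂‖ * 1 + ‖c₃‖ * 1 * 1) * ‖e‖ ^ l := by
      rw [h2]
      gcongr <;> exact pow_le_one₀ hr.le he.le
    _ = _ := by ring

lemma norm_one_add_le_of_re_add_eq_zero' (hA : conj A = A) (hAe : A * e * conj e = 1)
    (he : ‖e‖ < 1) (hc : c₁ ≠ 0) (hl : ‖c₃‖ * ‖e‖ ^ l ≤ ‖c₁‖ / 2)
    (h : (c₁ * A ^ l * (A * e) ^ k).re + (c₂ * e ^ l * (e * conj e) ^ k).re +
      (c₃ * conj e ^ l * (conj e * A) ^ k).re = 0) :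
    c₁ * A ^ l + conj c₃ * e ^ l ≠ 0 ∧
    ‖1 + (conj e * conj e * A) ^ k *
      (conj (c₁ * A ^ l + conj c₃ * e ^ l) / (c₁ * A ^ l + conj c₃ * e ^ l))‖ ≤
      4 * ‖c₂‖ / ‖c₁‖ * ‖e‖ ^ k := by
  have he0 : e ≠ 0 := by rintro rfl; simp at hAe
  have hr : 0 < ‖e‖ := norm_pos_iff.2 he0
  have hAn : ‖A‖ * (‖e‖ * ‖e‖) = 1 := by
    have := congrArg norm hAe
    rwa [norm_mul, norm_mul, RCLike.norm_conj, norm_one, mul_assoc] at this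
  have hA1 : 1 ≤ ‖A‖ := by
    by_contra! hlt
    have : ‖A‖ * (‖e‖ * ‖e‖) < 1 := by
      have : ‖e‖ * ‖e‖ < 1 := by nlinarith
      nlinarith [norm_nonneg A]
    linarith
  have hc' : 0 < ‖c₁‖ := norm_pos_iff.2 hc
  have hq : (A * e) ^ k * (conj e * conj e * A) ^ k = (A * conj e) ^ k := by
    rw [← mul_pow]
    congr 1
    linear_combination (A * conj e) * hAe
  set W := c₁ * A ^ l + conj c₃ * e ^ l with hWdef
  have hW : ‖c₁‖ / 2 ≤ ‖W‖ := by
    have h1 : ‖c₁ * A ^ l‖ - ‖conj c₃ * e ^ l‖ ≤ ‖W‖ := by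
      rw [hWdef]; simpa using norm_sub_norm_le (c₁ * A ^ l) (-(conj c₃ * e ^ l))
    have h2 : ‖c₁‖ ≤ ‖c₁ * A ^ l‖ := by
      rw [norm_mul, norm_pow]
      exact le_mul_of_one_le_right hc'.le (one_le_pow₀ hA1)
    rw [norm_mul (conj c₃), norm_pow, RCLike.norm_conj] at h1
    linarith
  have hW0 : W ≠ 0 := norm_pos_iff.1 (by linarith)
  refine ⟨hW0, ?_⟩
  have hX : (W * (A * e) ^ k) * (1 + (conj e * conj e * A) ^ k * (conj W / W)) =
      (c₁ * A ^ l * (A * e) ^ k + conj (c₁ * A ^ l * (A * e) ^ k)) +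
      (c₃ * conj e ^ l * (conj e * A) ^ k + conj (c₃ * conj e ^ l * (conj e * A) ^ k)) := by
    have : (W * (A * e) ^ k) * (1 + (conj e * conj e * A) ^ k * (conj W / W)) =
        W * (A * e) ^ k + conj W * (A * conj e) ^ k := by
      rw [← hq]
      field_simp
    rw [this, hWdef]
    simp only [map_mul, map_pow, map_add, hA, Complex.conj_conj]
    ring
  have hre : ∀ z : ℂ, z + conj z = (2 * z.re : ℝ) := Complex.add_conj
  have hnorm : ‖W‖ * (‖A‖ * ‖e‖) ^ k * ‖1 + (conj e * conj e * A) ^ k * (conj W / W)‖ ≤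
      2 * (‖c₂‖ * ‖e‖ ^ l * (‖e‖ * ‖e‖) ^ k) := by
    have := congrArg norm hX
    rw [hre, hre, norm_mul, norm_mul, norm_pow, norm_mul, ← Complex.ofReal_add,
      Complex.norm_real] at this
    rw [this, Real.norm_eq_abs]
    have h2 := Complex.abs_re_le_norm (c₂ * e ^ l * (e * conj e) ^ k)
    simp only [norm_mul, norm_pow, RCLike.norm_conj] at h2
    rw [abs_le] at h2 ⊢
    constructor <;> linarith
  have h2 : (‖A‖ * ‖e‖) ^ k * ‖e‖ ^ k = 1 := by
    rw [← mul_pow, mul_assoc, hAn, one_pow]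
  set S := ‖1 + (conj e * conj e * A) ^ k * (conj W / W)‖
  rw [div_mul_eq_mul_div, le_div_iff₀ hc']
  calc S * ‖c₁‖ ≤ S * (2 * ‖W‖) := by gcongr; linarith
    _ = 2 * (‖W‖ * (‖A‖ * ‖e‖) ^ k * S) * ‖e‖ ^ k := by linear_combination (-2 * S * ‖W‖) * h2
    _ ≤ 2 * (2 * (‖c₂‖ * ‖e‖ ^ l * (‖e‖ * ‖e‖) ^ k)) * ‖e‖ ^ k := by gcongr
    _ ≤ 2 * (2 * (‖c₂‖ * 1 * 1)) * ‖e‖ ^ k := by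
      gcongr
      · exact pow_le_one₀ hr.le he.le
      · exact pow_le_one₀ (by positivity) (by nlinarith)
    _ = _ := by ring

end

lemma natCast_lt_pow_succ_of_exp_neg_le {r C : ℝ} {N n b : ℕ} (hr : 0 < r) (hC : 0 ≤ C)
    (hN1 : 1 ≤ N) (hN : (1 + C) / -Real.log r ≤ N) (hr1 : r < 1)
    (h : Real.exp (-N ^ b) ≤ C * r ^ n) : n ≤ N ^ (b + 1) := by
  have ht : 0 < -Real.log r := by have := Real.log_neg hr hr1; linarith
  have h1 : C * r ^ n ≤ Real.exp (C + n * Real.log r) := by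
    rw [Real.exp_add, Real.exp_nat_mul, Real.exp_log hr]
    gcongr
    linarith [Real.add_one_le_exp C]
  have h2 := Real.exp_le_exp.1 (h.trans h1)
  rw [div_le_iff₀ ht] at hN
  have hN' : (1 : ℝ) ≤ (N : ℝ) ^ b := one_le_pow₀ (by exact_mod_cast hN1)
  have h3 : (n : ℝ) * -Real.log r ≤ (N : ℝ) ^ (b + 1) * -Real.log r := by
    calc (n : ℝ) * -Real.log r ≤ N ^ b + C := by linarith
      _ ≤ N ^ b * (1 + C) := by nlinarith
      _ ≤ N ^ b * (N * -Real.log r) := by gcongr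
      _ = _ := by ring
  exact_mod_cast le_of_mul_le_mul_right h3 ht

/-- If `ε` is a unit fixed by complex conjugation `τ` in a Galois sextic field with group
generated by `τ` and an element `σ` of order three, with `ε` large and its conjugates small, then
`c * ε ^ l * (ε * σ ε) ^ k` cannot have trace zero for large `l` and `k`. -/
theorem exists_forall_re_add_re_add_re_ne_zero {K : Type*} [Field K] [NumberField K]
    (φ : K →+* ℂ) {σ τ : K ≃ₐ[ℚ] K} (hτ : ∀ x, φ (τ x) = starRingEnd ℂ (φ x))
    (hσ : ∀ x, σ (σ (σ x)) = x) (hτσ : ∀ x, τ (σ x) = σ (σ (τ x))) {ε c : K}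
    (hεi : IsIntegral ℤ ε) (hci : IsIntegral ℤ c) (hc : c ≠ 0) (hτε : τ ε = ε)
    (hε : ε * σ ε * σ (σ ε) = 1) (hr : ‖φ (σ ε)‖ < 1) :
    ∃ M : ℕ, ∀ l k : ℕ, M ≤ l → M ≤ k → ∀ y : K, y = c * ε ^ l * (ε * σ ε) ^ k →
      (φ y).re + (φ (σ y)).re + (φ (σ (σ y))).re ≠ 0 := by
  have hint : ∀ (g : K ≃ₐ[ℚ] K) {x : K}, IsIntegral ℤ x → IsIntegral ℤ (g x) := fun g x hx ↦
    hx.map (g : K →+* K).toIntAlgHom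
  have he : φ (σ (σ ε)) = starRingEnd ℂ (φ (σ ε)) := by rw [← hτ, hτσ, hτε]
  have hA : starRingEnd ℂ (φ ε) = φ ε := by rw [← hτ, hτε]
  have hAe : φ ε * φ (σ ε) * starRingEnd ℂ (φ (σ ε)) = 1 := by
    rw [← he, ← map_mul, ← map_mul, hε, map_one]
  have hr0 : 0 < ‖φ (σ ε)‖ := by
    rw [norm_pos_iff]
    intro h
    simp [h] at hAe
  have hc1 : φ c ≠ 0 := by simpa using hc
  set r := ‖φ (σ ε)‖ with hrdef
  have hAn : ‖φ ε‖ * (r * r) = 1 := by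
    have := congrArg norm hAe
    rwa [norm_mul, norm_mul, RCLike.norm_conj, norm_one, mul_assoc] at this
  set θ : K := σ (σ ε) * σ (σ ε) * ε with hθdef
  have hφθ : φ θ = starRingEnd ℂ (φ (σ ε)) * starRingEnd ℂ (φ (σ ε)) * φ ε := by
    rw [hθdef, map_mul, map_mul, he]
  have hθi : IsIntegral ℤ θ := ((hint _ (hint _ hεi)).mul (hint _ (hint _ hεi))).mul hεi
  have hθ1 : ‖φ θ‖ = 1 := by
    rw [hφθ, norm_mul, norm_mul, RCLike.norm_conj]; linarith
  have hσθ : ‖φ (σ θ)‖ * r ^ 3 = 1 := by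
    simp only [hθdef, map_mul, hσ, norm_mul]
    calc _ = (‖φ ε‖ * (r * r)) * (‖φ ε‖ * (r * r)) := by ring
      _ = 1 := by rw [hAn]; norm_num
  have hθ : ∀ n : ℕ, 1 ≤ n → θ ^ n ≠ 1 := by
    intro n hn h
    have h1 : ‖φ (σ θ)‖ ^ n = 1 := by
      rw [← norm_pow, ← map_pow, ← map_pow, h, map_one, map_one, norm_one]
    rw [pow_eq_one_iff_of_nonneg (norm_nonneg _) (by omega)] at h1
    rw [h1, one_mul] at hσθ
    have := pow_lt_one₀ hr0.le hr (n := 3) (by norm_num)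
    linarith
  have hev := eventually_exp_neg_le_norm_one_add φ hτ hθi hθ1 hθ
  set c₁ := φ c
  set c₂ := φ (σ c)
  set c₃ := φ (σ (σ c))
  set Ca := 2 * (‖c₂‖ + ‖c₃‖) / ‖c₁‖
  set Cb := 4 * ‖c₂‖ / ‖c₁‖
  set H := 1 + house c + house ε + house (τ (σ (σ c))) + house (σ ε) with hHdef
  have hH1 : 1 ≤ H := by
    linarith [house_nonneg c, house_nonneg ε, house_nonneg (τ (σ (σ c))), house_nonneg (σ ε)]
  have hpow : Filter.Tendsto (fun N : ℕ ↦ N ^ 43) Filter.atTop Filter.atTop :=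
    Filter.tendsto_pow_atTop (by norm_num)
  have hN : ∀ᶠ N : ℕ in Filter.atTop, H ≤ Real.exp N ∧ 2 ≤ N ∧
      (1 + Ca) / -Real.log r ≤ N ∧ (1 + Cb) / -Real.log r ≤ N ∧
      2 * Real.log H + 1 ≤ N := by
    refine Filter.Eventually.and ?_ (Filter.Eventually.and (Filter.eventually_ge_atTop 2)
      (Filter.Eventually.and ?_ (Filter.Eventually.and ?_ ?_)))
    · exact (Real.tendsto_exp_atTop.comp tendsto_natCast_atTop_atTop).eventually_ge_atTop _
    all_goals exact tendsto_natCast_atTop_atTop.eventually_ge_atTop _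
  have hl : ∀ᶠ l : ℕ in Filter.atTop, ‖c₃‖ * r ^ l ≤ ‖c₁‖ / 2 := by
    have h0 := (tendsto_pow_atTop_nhds_zero_of_lt_one hr0.le hr).const_mul ‖c₃‖
    rw [mul_zero] at h0
    exact h0.eventually_le_const (half_pos (norm_pos_iff.2 hc1))
  have hk := tendsto_ceil_log_atTop.eventually (hev.and ((hpow.eventually hev).and hN))
  obtain ⟨M, hM⟩ := Filter.eventually_atTop.1 (hl.and (hk.and (eventually_ceil_log_pow_le 1807)))
  refine ⟨M, fun l k hlM hkM y hy hsum ↦ ?_⟩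
  have hl' := (hM l hlM).1
  obtain ⟨-, ⟨hev1, hev2, hHN, hN2, hNa, hNb, hNH⟩, hkN, hkexp⟩ := hM k hkM
  set N := ⌈Real.log k⌉₊
  have hNk : ∀ a ≤ 1807, N ^ a ≤ k := fun a ha ↦
    (Nat.pow_le_pow_right (Nat.zero_lt_of_lt hN2) ha).trans hkN
  have hσy : σ y = σ c * σ ε ^ l * (σ ε * σ (σ ε)) ^ k := by simp [hy]
  have hσσy : σ (σ y) = σ (σ c) * σ (σ ε) ^ l * (σ (σ ε) * ε) ^ k := by simp [hσy, hσ]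
  rw [hσσy, hσy, hy] at hsum
  simp only [map_mul, map_pow, he] at hsum
  have hstepA := norm_one_add_le_of_re_add_eq_zero hA hAe hr hc1 hsum
  obtain ⟨hW0, hstepB⟩ := norm_one_add_le_of_re_add_eq_zero' hA hAe hr hc1 hl' hsum
  have hlN : l ≤ N ^ 42 := by
    refine natCast_lt_pow_succ_of_exp_neg_le hr0 (by positivity) (by omega) hNa hr
      (le_trans ?_ hstepA)
    have := hev1 c k hci hc (fun ψ ↦ (norm_embedding_le_house c ψ).trans
      (le_trans (by linarith [house_nonneg ε, house_nonneg (τ (σ (σ c))), house_nonneg (σ ε)])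
        hHN)) (hNk 11 (by norm_num)) hkexp
    rwa [hφθ, hτ] at this
  set w := c * ε ^ l + τ (σ (σ c)) * σ ε ^ l with hw
  have hφw : φ w = c₁ * φ ε ^ l + starRingEnd ℂ c₃ * φ (σ ε) ^ l := by
    rw [hw, map_add, map_mul, map_mul, map_pow, map_pow, hτ]
  have hwH : ∀ ψ : K →+* ℂ, ‖ψ w‖ ≤ Real.exp (N ^ 43 : ℕ) := by
    intro ψ
    have hb : ∀ x, house x ≤ H → ‖ψ x‖ ≤ H := fun x hx ↦ (norm_embedding_le_house x ψ).trans hx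
    have h1 : ‖ψ w‖ ≤ H * H ^ l + H * H ^ l := by
      rw [hw, map_add, map_mul, map_mul, map_pow, map_pow]
      refine (norm_add_le _ _).trans ?_
      rw [norm_mul, norm_mul, norm_pow, norm_pow]
      gcongr <;> apply hb <;> linarith [house_nonneg c, house_nonneg ε,
        house_nonneg (τ (σ (σ c))), house_nonneg (σ ε)]
    have h2 : H * H ^ l + H * H ^ l ≤ Real.exp (1 + (l + 1) * Real.log H) := by
      have : Real.exp ((l + 1 : ℕ) * Real.log H) = H ^ (l + 1) := by
        rw [Real.exp_nat_mul, Real.exp_log (by linarith)]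
      push_cast at this
      rw [Real.exp_add, this]
      nlinarith [Real.add_one_le_exp 1, pow_pos (by linarith : 0 < H) (l + 1), pow_succ H l]
    refine h1.trans (h2.trans (Real.exp_le_exp.2 ?_))
    have hlogH : 0 ≤ Real.log H := Real.log_nonneg hH1
    have hlN' : (l : ℝ) ≤ (N : ℝ) ^ 42 := by exact_mod_cast hlN
    have hN1 : (1 : ℝ) ≤ (N : ℝ) ^ 42 := one_le_pow₀ (by exact_mod_cast (by omega : 1 ≤ N))
    push_cast
    calc 1 + (l + 1) * Real.log H ≤ N ^ 42 + (N ^ 42 + N ^ 42) * Real.log H := by gcongr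
      _ = N ^ 42 * (2 * Real.log H + 1) := by ring
      _ ≤ N ^ 42 * N := by gcongr
      _ = N ^ 43 := by ring
  have hk43 : (k : ℝ) ≤ Real.exp (N ^ 43 : ℕ) := hkexp.trans (Real.exp_le_exp.2 (by
    exact_mod_cast Nat.le_self_pow (by norm_num) N))
  have hkN' : k ≤ (N ^ 43) ^ (41 + 1) := by
    refine natCast_lt_pow_succ_of_exp_neg_le hr0 (by positivity) (Nat.one_le_pow _ _ (by omega))
      (hNb.trans (by exact_mod_cast Nat.le_self_pow (by norm_num) N)) hr (le_trans ?_ hstepB)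
    have hw0 : w ≠ 0 := by
      intro h
      rw [h, map_zero] at hφw
      exact hW0 hφw.symm
    have := hev2 w k ((hci.mul (hεi.pow l)).add
      ((hint τ (hint σ (hint σ hci))).mul ((hint σ hεi).pow l))) hw0 hwH
      (by rw [← pow_mul]; exact hNk _ (by norm_num)) hk43
    rwa [hφθ, hτ, hφw] at this
  rw [← pow_mul] at hkN'
  have h1 : N ^ (43 * (41 + 1)) < N ^ 1807 := Nat.pow_lt_pow_right (by omega) (by norm_num)
  have := hNk 1807 le_rfl
  omega

lemma exists_infinite_fiber_of_mapsTo {X Y : Type*} {E : Set X} (hE : E.Infinite) {f : X → Y}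
    {T : Set Y} (hT : T.Finite) (hf : Set.MapsTo f E T) :
    ∃ y ∈ T, {x ∈ E | f x = y}.Infinite := by
  by_contra! h
  refine hE ((hT.biUnion h).subset fun x hx ↦ ?_)
  simp only [Set.mem_iUnion]
  exact ⟨f x, hf hx, hx, rfl⟩

lemma eq_of_order_three_of_order_two {G : Type*} [Group G] {σ τ : G} (hσ1 : σ ≠ 1)
    (hσ : σ * σ * σ = 1) (hτ1 : τ ≠ 1) (hτ : τ * τ = 1) :
    Function.Injective ![1, σ, σ * σ, τ, τ * σ, τ * (σ * σ)] := by
  have hσσ : σ * σ ≠ 1 := fun h ↦ hσ1 (by rwa [h, one_mul] at hσ)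
  have hσ' : σ⁻¹ = σ * σ := inv_eq_of_mul_eq_one_left hσ
  have h1 : τ ≠ σ := by
    rintro rfl
    exact hσσ hτ
  have h2 : τ ≠ σ * σ := by
    rintro rfl
    apply hσ1
    calc σ = σ * (σ * σ * σ) := by rw [hσ, mul_one]
      _ = 1 := by rw [← hτ]; group
  have hσa : σ * (σ * σ) = 1 := by rw [← mul_assoc, hσ]
  have key : ∀ a b : G, (a = 1 ∨ a = σ ∨ a = σ * σ) → (b = 1 ∨ b = σ ∨ b = σ * σ) →
      a ≠ τ * b := by
    intro a b ha hb h
    have hτ' : τ = a * b⁻¹ := by rw [h]; group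
    rcases ha with rfl | rfl | rfl <;> rcases hb with rfl | rfl | rfl <;>
      simp [hσ', mul_assoc, hσa, h1, h2, hτ1] at hτ'
  have h3 : σ ≠ σ * σ := fun h ↦ hσ1 (by simpa using h)
  intro i j h
  fin_cases i <;> fin_cases j <;> first
    | rfl
    | (exfalso; simp at h; tauto)
    | (exfalso; exact key _ _ (by simp) (by simp) h)
    | (exfalso; exact key _ _ (by simp) (by simp) h.symm)

lemma exists_order_three_bijective {G : Type*} [Group G] [Finite G] (hG : Nat.card G = 6) {τ : G}
    (hτ1 : τ ≠ 1) (hτ : τ * τ = 1) (hτc : ∃ g, τ * g ≠ g * τ) :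
    ∃ σ : G, σ * σ * σ = 1 ∧ τ * σ = σ * σ * τ ∧
      Function.Bijective ![1, σ, σ * σ, τ, τ * σ, τ * (σ * σ)] := by
  have : Fact (Nat.Prime 3) := ⟨Nat.prime_three⟩
  obtain ⟨σ, hσ⟩ := exists_prime_orderOf_dvd_card' (G := G) 3 (by rw [hG]; norm_num)
  have hσ3 : σ * σ * σ = 1 := by rw [← pow_orderOf_eq_one σ, hσ, pow_three']
  have hσ1 : σ ≠ 1 := by
    rintro rfl
    simp at hσ
  have hinj := eq_of_order_three_of_order_two hσ1 hσ3 hτ1 hτ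
  have hbij : Function.Bijective ![1, σ, σ * σ, τ, τ * σ, τ * (σ * σ)] :=
    (Nat.bijective_iff_injective_and_card _).2 ⟨hinj, by rw [hG]; simp⟩
  refine ⟨σ, hσ3, ?_, hbij⟩
  obtain ⟨i, hi⟩ := hbij.2 (σ * τ)
  have hne : ∀ a : Fin 6, ∀ b : Fin 6, ![1, σ, σ * σ, τ, τ * σ, τ * (σ * σ)] a =
    ![1, σ, σ * σ, τ, τ * σ, τ * (σ * σ)] b → a = b := fun a b h ↦ hinj h
  fin_cases i
  · exact absurd (hne 3 2 (by
      have : σ * τ = 1 := hi.symm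
      calc τ = σ * σ * (σ * τ) := by rw [← mul_assoc, hσ3, one_mul]
        _ = σ * σ := by rw [this, mul_one])) (by decide)
  · exact absurd (hne 3 0 (by simpa using hi)) (by decide)
  · exact absurd (hne 3 1 (by simpa using hi.symm)) (by decide)
  · exact absurd hi.symm (by simpa using hσ1)
  · exfalso
    have hi : τ * σ = σ * τ := hi
    obtain ⟨g, hg⟩ := hτc
    obtain ⟨j, rfl⟩ := hbij.2 g
    apply hg
    have hc : Commute τ σ := hi
    have hcc : Commute τ τ := Commute.refl τ
    fin_cases j
    · exact Commute.one_right τ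
    · exact hc
    · exact hc.mul_right hc
    · exact hcc
    · exact hcc.mul_right hc
    · exact hcc.mul_right (hc.mul_right hc)
  · have hi : τ * (σ * σ) = σ * τ := hi
    calc τ * σ = τ * σ * (σ * σ * σ) := by rw [hσ3, mul_one]
      _ = τ * (σ * σ) * (σ * σ) := by simp only [mul_assoc]
      _ = σ * τ * (σ * σ) := by rw [hi]
      _ = σ * (τ * (σ * σ)) := mul_assoc _ _ _
      _ = σ * σ * τ := by rw [hi, mul_assoc]

lemma exists_algEquiv_comp_eq {K : Type*} [Field K] [NumberField K] [IsGalois ℚ K]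
    (φ ψ : K →+* ℂ) : ∃ g : K ≃ₐ[ℚ] K, ∀ x, ψ x = φ (g x) := by
  obtain ⟨g, rfl⟩ := ComplexEmbedding.exists_comp_symm_eq_of_comp_eq (k := ℚ) φ ψ
    (Subsingleton.elim _ _)
  exact ⟨g.symm, fun x ↦ rfl⟩

/-- The automorphism `τ` is complex conjugation in the embedding `φ`, and together with the
element `σ` of order three it generates the Galois group, which is dihedral of order six. -/
structure IsDihedralPair {K : Type*} [Field K] [NumberField K] (φ : K →+* ℂ)
    (σ τ : K ≃ₐ[ℚ] K) : Prop where
  conj : ∀ x, φ (τ x) = starRingEnd ℂ (φ x)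
  order_three : ∀ x, σ (σ (σ x)) = x
  involutive : ∀ x, τ (τ x) = x
  comm : ∀ x, τ (σ x) = σ (σ (τ x))
  bijective : Function.Bijective ![1, σ, σ * σ, τ, τ * σ, τ * (σ * σ)]

namespace IsDihedralPair

variable {K : Type*} [Field K] [NumberField K] {φ : K →+* ℂ} {σ τ : K ≃ₐ[ℚ] K}

lemma comm' (h : IsDihedralPair φ σ τ) (x : K) : σ (τ x) = τ (σ (σ x)) := by
  rw [h.comm, h.comm, h.order_three]

lemma norm_conj (h : IsDihedralPair φ σ τ) (x : K) : ‖φ (τ x)‖ = ‖φ x‖ := by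
  rw [h.conj, RCLike.norm_conj]

lemma norm_embedding_le [IsGalois ℚ K] (h : IsDihedralPair φ σ τ) {x : K} {B : ℝ}
    (h1 : ‖φ x‖ ≤ B) (h2 : ‖φ (σ x)‖ ≤ B) (h3 : ‖φ (σ (σ x))‖ ≤ B) (ψ : K →+* ℂ) :
    ‖ψ x‖ ≤ B := by
  obtain ⟨g, hg⟩ := exists_algEquiv_comp_eq φ ψ
  obtain ⟨i, rfl⟩ := h.bijective.2 g
  rw [hg]
  fin_cases i
  · exact h1
  · exact h2
  · exact h3
  · exact (h.norm_conj _).trans_le h1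
  · exact (h.norm_conj _).trans_le h2
  · exact (h.norm_conj _).trans_le h3

lemma re_add_re_add_re_eq_zero [IsGalois ℚ K] (h : IsDihedralPair φ σ τ) {x : K}
    (hx : Algebra.trace ℚ K x = 0) : (φ x).re + (φ (σ x)).re + (φ (σ (σ x))).re = 0 := by
  have := trace_eq_sum_automorphisms (K := ℚ) x
  rw [hx, map_zero, ← h.bijective.sum_comp, Fin.sum_univ_six] at this
  have h0 := congrArg (fun z ↦ (φ z).re) this
  simp only [Matrix.cons_val, AlgEquiv.one_apply, AlgEquiv.mul_apply, map_add, h.conj,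
    Complex.add_re, Complex.conj_re, map_zero, Complex.zero_re] at h0
  linarith

lemma prod_eq_one [IsGalois ℚ K] (h : IsDihedralPair φ σ τ) {x : K}
    (hx : Algebra.norm ℚ x = 1) :
    x * τ x * σ (x * τ x) * σ (σ (x * τ x)) = 1 := by
  have := Algebra.norm_eq_prod_automorphisms (K := ℚ) x
  rw [hx, map_one, ← h.bijective.prod_comp, Fin.prod_univ_six] at this
  simp only [Matrix.cons_val, AlgEquiv.one_apply, AlgEquiv.mul_apply] at this
  simp only [map_mul, h.comm', h.order_three]
  rw [this]
  ring

lemma norm_mul_norm_mul_norm [IsGalois ℚ K] (h : IsDihedralPair φ σ τ) {x : K}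
    (hx : Algebra.norm ℚ x = 1) : ‖φ x‖ * ‖φ (σ x)‖ * ‖φ (σ (σ x))‖ = 1 := by
  have h1 := congrArg (fun z ↦ ‖φ z‖) (h.prod_eq_one hx)
  simp only [map_mul, norm_mul, h.comm', h.order_three, h.norm_conj, map_one, norm_one] at h1
  have h2 : (‖φ x‖ * ‖φ (σ x)‖ * ‖φ (σ (σ x))‖) ^ 2 = 1 := by rw [← h1]; ring
  exact (pow_eq_one_iff_of_nonneg (by positivity) two_ne_zero).1 h2

/-- Some automorphism sorts the absolute values of the conjugates of `x`. -/
lemma exists_norm_le_norm_le (h : IsDihedralPair φ σ τ) (x : K) :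
    ∃ g : K ≃ₐ[ℚ] K, ‖φ (σ (g x))‖ ≤ ‖φ (σ (σ (g x)))‖ ∧ ‖φ (σ (σ (g x)))‖ ≤ ‖φ (g x)‖ := by
  rcases le_total ‖φ x‖ ‖φ (σ x)‖ with hab | hab <;>
    rcases le_total ‖φ x‖ ‖φ (σ (σ x))‖ with hac | hac <;>
    rcases le_total ‖φ (σ x)‖ ‖φ (σ (σ x))‖ with hbc | hbc
  all_goals first
    | (refine ⟨1, ?_, ?_⟩ <;>
        simp only [AlgEquiv.one_apply] <;> assumption)
    | (refine ⟨σ, ?_, ?_⟩ <;>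
        simp only [h.order_three] <;> assumption)
    | (refine ⟨σ * σ, ?_, ?_⟩ <;>
        simp only [AlgEquiv.mul_apply, h.order_three] <;> assumption)
    | (refine ⟨τ, ?_, ?_⟩ <;>
        simp only [h.order_three, h.comm', h.norm_conj] <;> assumption)
    | (refine ⟨τ * σ, ?_, ?_⟩ <;>
        simp only [AlgEquiv.mul_apply, h.order_three, h.comm', h.norm_conj] <;> assumption)
    | (refine ⟨τ * (σ * σ), ?_, ?_⟩ <;>
        simp only [AlgEquiv.mul_apply, h.order_three, h.comm', h.norm_conj] <;> assumption)

end IsDihedralPair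

lemma exists_int_ne_zero_isIntegral_mul {K : Type*} [Field K] [NumberField K] (z : K) :
    ∃ D : ℤ, D ≠ 0 ∧ IsIntegral ℤ ((D : K) * z) := by
  obtain ⟨D, hD, h⟩ := IsAlgebraic.exists_integral_multiple
    ((IsFractionRing.isAlgebraic_iff ℤ ℚ K).2 (Algebra.IsAlgebraic.isAlgebraic z))
  exact ⟨D, hD, by rwa [← zsmul_eq_mul]⟩

namespace IsDihedralPair

variable {K : Type*} [Field K] [NumberField K] [IsGalois ℚ K] {φ : K →+* ℂ} {σ τ : K ≃ₐ[ℚ] K}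

/-- An element of norm one with sorted conjugates is a product of powers of `ε` and `ε * σ ε`
up to an element all of whose conjugates are bounded. -/
lemma exists_eq_mul_pow_mul_pow (h : IsDihedralPair φ σ τ) {ε x : K} (hεi : IsIntegral ℤ ε)
    (hτε : τ ε = ε) (hε : ε * σ ε * σ (σ ε) = 1) (hr : ‖φ (σ ε)‖ < 1) (hxi : IsIntegral ℤ x)
    (hx : Algebra.norm ℚ x = 1) (hx1 : ‖φ (σ x)‖ ≤ ‖φ (σ (σ x))‖)
    (hx2 : ‖φ (σ (σ x))‖ ≤ ‖φ x‖) :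
    ∃ (l k : ℕ) (f : K), IsIntegral ℤ f ∧ (∀ ψ : K →+* ℂ, ‖ψ f‖ ≤ (‖φ (σ ε)‖ ^ 3)⁻¹) ∧
      x = f * ε ^ l * (ε * σ ε) ^ k := by
  have hint : ∀ (g : K ≃ₐ[ℚ] K) {x : K}, IsIntegral ℤ x → IsIntegral ℤ (g x) := fun g x hx ↦
    hx.map (g : K →+* K).toIntAlgHom
  have hσσε : ‖φ (σ (σ ε))‖ = ‖φ (σ ε)‖ := by rw [← h.norm_conj, h.comm, h.comm, hτε, h.order_three]
  have hεn := congrArg (fun z ↦ ‖φ z‖) hε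
  simp only [map_mul, norm_mul, map_one, norm_one, hσσε] at hεn
  have hr0 : 0 < ‖φ (σ ε)‖ := by
    by_contra! h0
    rw [le_antisymm h0 (norm_nonneg _)] at hεn
    simp at hεn
  have hxn := h.norm_mul_norm_mul_norm hx
  have hpos : ∀ z : K, z ≠ 0 → 0 < ‖φ z‖ := fun z hz ↦ norm_pos_iff.2 (by simpa using hz)
  have hx0 : x ≠ 0 := by rintro rfl; simp at hx
  have ha := hpos x hx0
  have hb := hpos (σ x) (by simpa using hx0)
  have hc := hpos (σ (σ x)) (by simpa using hx0)
  set a := ‖φ x‖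
  set b := ‖φ (σ x)‖
  set c := ‖φ (σ (σ x))‖
  set r := ‖φ (σ ε)‖ with hrdef
  set t := -Real.log r with htdef
  have ht : 0 < t := by have := Real.log_neg hr0 hr; linarith
  have hsum : Real.log a + Real.log b + Real.log c = 0 := by
    rw [← Real.log_mul ha.ne' hb.ne', ← Real.log_mul (by positivity) hc.ne', hxn, Real.log_one]
  have hfloor : ∀ y : ℝ, 0 ≤ y → ∃ n : ℕ, n * (3 * t) ≤ y ∧ y ≤ (n + 1) * (3 * t) := by
    intro y hy
    refine ⟨⌊y / (3 * t)⌋₊, ?_, ?_⟩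
    · rw [← le_div_iff₀ (by positivity)]
      exact Nat.floor_le (by positivity)
    · rw [← div_le_iff₀ (by positivity)]
      exact (Nat.lt_floor_add_one _).le
  obtain ⟨l, hl1, hl2⟩ := hfloor _ (sub_nonneg.2 (Real.log_le_log hc hx2))
  obtain ⟨k, hk1, hk2⟩ := hfloor _ (sub_nonneg.2 (Real.log_le_log hb hx1))
  set f := x * (σ ε * σ (σ ε)) ^ l * σ (σ ε) ^ k with hf
  have hAn : ‖φ ε‖ = Real.exp (2 * t) := by
    rw [htdef, ← Real.log_inv, ← Nat.cast_two, Real.exp_nat_mul, Real.exp_log (by positivity)]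
    field_simp
    linarith
  have hrt : r = Real.exp (-t) := by rw [htdef, neg_neg, Real.exp_log hr0]
  have hB : (r ^ 3)⁻¹ = Real.exp (3 * t) := by
    rw [hrt, ← Real.exp_nat_mul, ← Real.exp_neg]
    congr 1
    push_cast
    ring
  refine ⟨l, k, f, ?_, ?_, ?_⟩
  · exact (hxi.mul (((hint _ hεi).mul (hint _ (hint _ hεi))).pow l)).mul
      ((hint _ (hint _ hεi)).pow k)
  · rw [hB]
    have hA : ∀ u v w : ℝ, ∀ m n : ℕ, Real.exp u * Real.exp v ^ m * Real.exp w ^ n =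
        Real.exp (u + m * v + n * w) := by
      intro u v w m n
      rw [Real.exp_add, Real.exp_add, Real.exp_nat_mul, Real.exp_nat_mul]
    have ha' : ‖φ x‖ = Real.exp (Real.log a) := (Real.exp_log ha).symm
    have hb' : ‖φ (σ x)‖ = Real.exp (Real.log b) := (Real.exp_log hb).symm
    have hc' : ‖φ (σ (σ x))‖ = Real.exp (Real.log c) := (Real.exp_log hc).symm
    apply h.norm_embedding_le <;>
      simp only [hf, map_mul, map_pow, norm_mul, norm_pow, hσσε, h.order_three, ha', hb', hc',
        hAn, ← hrdef] <;>
      rw [hrt, ← Real.exp_add, hA] <;>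
      exact Real.exp_le_exp.2 (by linarith)
  · calc x = x * (ε * σ ε * σ (σ ε)) ^ (l + k) := by rw [hε, one_pow, mul_one]
      _ = _ := by rw [hf]; ring

end IsDihedralPair

namespace IsDihedralPair

variable {K : Type*} [Field K] [NumberField K] [IsGalois ℚ K] {φ : K →+* ℂ} {σ τ : K ≃ₐ[ℚ] K}

lemma exists_infinite_ratio_fixed_of_sorted (h : IsDihedralPair φ σ τ) (hτ1 : τ ≠ 1) {ε β : K}
    (hεi : IsIntegral ℤ ε) (hτε : τ ε = ε) (hε : ε * σ ε * σ (σ ε) = 1) (hr : ‖φ (σ ε)‖ < 1)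
    (hβ : β ≠ 0) {E : Set K} (hE : E.Infinite) (hEi : ∀ x ∈ E, IsIntegral ℤ x)
    (hEn : ∀ x ∈ E, Algebra.norm ℚ x = 1)
    (hEs : ∀ x ∈ E, ‖φ (σ x)‖ ≤ ‖φ (σ (σ x))‖ ∧ ‖φ (σ (σ x))‖ ≤ ‖φ x‖)
    (htr : ∀ x ∈ E, Algebra.trace ℚ K (β * x) = 0) :
    ∃ ρ : K ≃ₐ[ℚ] K, ρ ≠ 1 ∧ ρ * ρ = 1 ∧ ∃ x₀ ∈ E, {x ∈ E | ρ (x / x₀) = x / x₀}.Infinite := by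
  have hdec : ∀ x : K, ∃ (l k : ℕ) (f : K), x ∈ E → (IsIntegral ℤ f ∧
      (∀ ψ : K →+* ℂ, ‖ψ f‖ ≤ (‖φ (σ ε)‖ ^ 3)⁻¹)) ∧ x = f * ε ^ l * (ε * σ ε) ^ k := by
    intro x
    by_cases hx : x ∈ E
    · obtain ⟨l, k, f, h1, h2, h3⟩ := h.exists_eq_mul_pow_mul_pow hεi hτε hε hr (hEi x hx)
        (hEn x hx) (hEs x hx).1 (hEs x hx).2
      exact ⟨l, k, f, fun _ ↦ ⟨⟨h1, h2⟩, h3⟩⟩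
    · exact ⟨0, 0, 0, fun hx' ↦ absurd hx' hx⟩
  choose l k F hF using hdec
  obtain ⟨f, ⟨hfi, -⟩, hE1⟩ := exists_infinite_fiber_of_mapsTo hE
    (Embeddings.finite_of_norm_le K ℂ (‖φ (σ ε)‖ ^ 3)⁻¹) (f := F) (fun x hx ↦ (hF x hx).1)
  have hx0 : ∀ x ∈ E, x ≠ 0 := by
    rintro x hx rfl
    simpa using hEn 0 hx
  have hε0 : ε ≠ 0 := by rintro rfl; simp at hε
  have hσε0 : σ ε ≠ 0 := by simpa using hε0
  have hf0 : f ≠ 0 := by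
    obtain ⟨x, hx, hxf⟩ := hE1.nonempty
    rintro rfl
    exact hx0 x hx (by rw [(hF x hx).2, hxf]; ring)
  obtain ⟨D, hD, hDi⟩ := exists_int_ne_zero_isIntegral_mul β
  obtain ⟨M, hM⟩ := exists_forall_re_add_re_add_re_ne_zero φ h.conj h.order_three h.comm hεi
    (hDi.mul hfi) (mul_ne_zero (mul_ne_zero (by exact_mod_cast hD) hβ) hf0) hτε hε hr
  have hlk : ∀ x ∈ {x ∈ E | F x = f}, l x < M ∨ k x < M := by
    rintro x ⟨hx, hxf⟩
    by_contra! hcon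
    refine hM (l x) (k x) hcon.1 hcon.2 (D * (β * x)) ?_ (h.re_add_re_add_re_eq_zero ?_)
    · conv_lhs => rw [(hF x hx).2, hxf]
      ring
    · rw [← zsmul_eq_mul, map_zsmul, htr x hx, smul_zero]
  have hsplit : {x ∈ {x ∈ E | F x = f} | l x < M}.Infinite ∨
      {x ∈ {x ∈ E | F x = f} | k x < M}.Infinite := by
    rw [← Set.infinite_union]
    exact hE1.mono fun x hx ↦ (hlk x hx).imp (fun h ↦ ⟨hx, h⟩) (fun h ↦ ⟨hx, h⟩)
  rcases hsplit with hinf | hinf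
  · obtain ⟨l₀, -, hE2⟩ := exists_infinite_fiber_of_mapsTo hinf (Set.finite_lt_nat M) (f := l)
      (fun x hx ↦ hx.2)
    obtain ⟨x₀, ⟨⟨hx₀, hf₀⟩, -⟩, hl₀⟩ := hE2.nonempty
    refine ⟨σ * (σ * (τ * σ)), ?_, ?_, x₀, hx₀, hE2.mono ?_⟩
    · intro hρ
      apply hτ1
      ext x
      have := congrArg (fun g ↦ σ (g (σ (σ x)))) hρ
      simpa [h.order_three] using this
    · ext x
      simp [h.order_three, h.involutive]
    · rintro x ⟨⟨⟨hx, hxf⟩, -⟩, hl⟩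
      refine ⟨hx, ?_⟩
      have hratio : x / x₀ = (ε * σ ε) ^ k x / (ε * σ ε) ^ k x₀ := by
        conv_lhs => rw [(hF x hx).2, (hF x₀ hx₀).2, hxf, hf₀, hl, hl₀]
        exact mul_div_mul_left _ _ (mul_ne_zero hf0 (pow_ne_zero _ hε0))
      have hfix : σ (σ (τ (σ (ε * σ ε)))) = ε * σ ε := by
        simp only [map_mul, h.comm, h.order_three, hτε]
        ring
      simp only [hratio, map_div₀, map_pow, AlgEquiv.mul_apply, hfix]
  · obtain ⟨k₀, -, hE2⟩ := exists_infinite_fiber_of_mapsTo hinf (Set.finite_lt_nat M) (f := k)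
      (fun x hx ↦ hx.2)
    obtain ⟨x₀, ⟨⟨hx₀, hf₀⟩, -⟩, hk₀⟩ := hE2.nonempty
    refine ⟨τ, hτ1, AlgEquiv.ext h.involutive, x₀, hx₀, hE2.mono ?_⟩
    rintro x ⟨⟨⟨hx, hxf⟩, -⟩, hk⟩
    refine ⟨hx, ?_⟩
    have hratio : x / x₀ = ε ^ l x / ε ^ l x₀ := by
      conv_lhs => rw [(hF x hx).2, (hF x₀ hx₀).2, hxf, hf₀, hk, hk₀]
      field_simp
    simp only [hratio, map_div₀, map_pow, hτε]

/-- An infinite set of units in a hyperplane contains infinitely many with ratios in a fixed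
cubic field. -/
lemma exists_infinite_ratio_fixed (h : IsDihedralPair φ σ τ) (hτ1 : τ ≠ 1) {β : K} (hβ : β ≠ 0)
    {E : Set K} (hE : E.Infinite) (hEi : ∀ x ∈ E, IsIntegral ℤ x)
    (hEn : ∀ x ∈ E, Algebra.norm ℚ x = 1)
    (htr : ∀ x ∈ E, Algebra.trace ℚ K (β * x) = 0) :
    ∃ ρ : K ≃ₐ[ℚ] K, ρ ≠ 1 ∧ ρ * ρ = 1 ∧ ∃ x₀ ∈ E, {x ∈ E | ρ (x / x₀) = x / x₀}.Infinite := by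
  have hint : ∀ (g : K ≃ₐ[ℚ] K) {x : K}, IsIntegral ℤ x → IsIntegral ℤ (g x) := fun g x hx ↦
    hx.map (g : K →+* K).toIntAlgHom
  have hnorm : ∀ (g : K ≃ₐ[ℚ] K) (x : K), Algebra.norm ℚ (g x) = Algebra.norm ℚ x :=
    fun g x ↦ Algebra.norm_eq_of_algEquiv g x
  have htrace : ∀ (g : K ≃ₐ[ℚ] K) (x : K), Algebra.trace ℚ K (g x) = Algebra.trace ℚ K x :=
    fun g x ↦ Algebra.trace_eq_of_algEquiv g x
  obtain ⟨z, hzi, hz, hz1⟩ : ∃ z : K, IsIntegral ℤ z ∧ Algebra.norm ℚ z = 1 ∧ 1 < ‖φ z‖ := by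
    by_contra! hcon
    refine hE ((Embeddings.finite_of_norm_le K ℂ 1).subset fun x hx ↦ ⟨hEi x hx, fun ψ ↦ ?_⟩)
    obtain ⟨g, hg⟩ := exists_algEquiv_comp_eq φ ψ
    rw [hg]
    exact hcon _ (hint g (hEi x hx)) (by rw [hnorm, hEn x hx])
  set ε := z * τ z with hεdef
  have hεi : IsIntegral ℤ ε := hzi.mul (hint τ hzi)
  have hτε : τ ε = ε := by rw [hεdef, map_mul, h.involutive, mul_comm]
  have hε : ε * σ ε * σ (σ ε) = 1 := h.prod_eq_one hz
  have hr : ‖φ (σ ε)‖ < 1 := by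
    have h1 : 1 < ‖φ ε‖ := by
      rw [hεdef, map_mul, norm_mul, h.norm_conj]
      nlinarith
    have h2 : ‖φ (σ (σ ε))‖ = ‖φ (σ ε)‖ := by rw [← h.norm_conj, h.comm, h.comm, hτε, h.order_three]
    have h3 := congrArg (fun z ↦ ‖φ z‖) hε
    simp only [map_mul, norm_mul, map_one, norm_one, h2] at h3
    by_contra! h4
    have h5 := one_lt_mul_of_lt_of_le (one_lt_mul_of_lt_of_le h1 h4) h4
    linarith
  choose g hg using h.exists_norm_le_norm_le
  obtain ⟨g₀, -, hE1⟩ := exists_infinite_fiber_of_mapsTo hE (Set.finite_univ) (f := g)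
    (fun x _ ↦ Set.mem_univ _)
  obtain ⟨ρ, hρ1, hρ, y₀, ⟨x₀, ⟨hx₀, -⟩, rfl⟩, hinf⟩ := h.exists_infinite_ratio_fixed_of_sorted hτ1
    hεi hτε hε hr (β := g₀ β) (by simpa using hβ)
    (E := g₀ '' {x ∈ E | g x = g₀}) (hE1.image g₀.injective.injOn)
    (by rintro _ ⟨x, ⟨hx, -⟩, rfl⟩; exact hint _ (hEi x hx))
    (by rintro _ ⟨x, ⟨hx, -⟩, rfl⟩; rw [hnorm, hEn x hx])
    (by rintro _ ⟨x, ⟨hx, rfl⟩, rfl⟩; exact hg x)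
    (by rintro _ ⟨x, ⟨hx, -⟩, rfl⟩; rw [← map_mul, htrace, htr x hx])
  refine ⟨g₀⁻¹ * (ρ * g₀), ?_, ?_, x₀, hx₀, ?_⟩
  · intro h
    apply hρ1
    calc ρ = g₀ * (g₀⁻¹ * (ρ * g₀)) * g₀⁻¹ := by group
      _ = 1 := by rw [h]; group
  · calc g₀⁻¹ * (ρ * g₀) * (g₀⁻¹ * (ρ * g₀)) = g₀⁻¹ * (ρ * ρ) * g₀ := by group
      _ = 1 := by rw [hρ]; group
  · refine Set.Infinite.of_image g₀ (hinf.mono ?_)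
    rintro _ ⟨⟨x, ⟨hx, -⟩, rfl⟩, hfix⟩
    refine ⟨x, ⟨hx, ?_⟩, rfl⟩
    rw [← map_div₀] at hfix
    rw [AlgEquiv.mul_apply, AlgEquiv.mul_apply, hfix]
    exact g₀.symm_apply_apply _

end IsDihedralPair

/-- An infinite set of units of a totally complex Galois sextic field which lie in a hyperplane
contains infinitely many with ratios fixed by a common involution. -/
theorem exists_infinite_ratio_fixed_of_trace_eq_zero {K : Type*} [Field K] [NumberField K]
    [IsGalois ℚ K] (hdeg : Module.finrank ℚ K = 6)
    (htc : ∀ φ : K →+* ℂ, ¬ ComplexEmbedding.IsReal φ) {β : K} (hβ : β ≠ 0)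
    {E : Set K} (hE : E.Infinite) (hEi : ∀ x ∈ E, IsIntegral ℤ x ∧ IsIntegral ℤ x⁻¹)
    (hEn : ∀ x ∈ E, Algebra.norm ℚ x = 1)
    (htr : ∀ x ∈ E, Algebra.trace ℚ K (β * x) = 0) :
    ∃ ρ : K ≃ₐ[ℚ] K, ρ ≠ 1 ∧ ρ * ρ = 1 ∧ ∃ x₀ ∈ E, {x ∈ E | ρ (x / x₀) = x / x₀}.Infinite := by
  obtain ⟨φ⟩ : Nonempty (K →+* ℂ) := inferInstance
  obtain ⟨τ, hτ⟩ := exists_algEquiv_comp_eq φ (ComplexEmbedding.conjugate φ)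
  have hconj : ∀ x, φ (τ x) = starRingEnd ℂ (φ x) := fun x ↦ (hτ x).symm
  have hττ : ∀ x, τ (τ x) = x := fun x ↦ φ.injective (by rw [hconj, hconj, Complex.conj_conj])
  have hτ2 : τ * τ = 1 := AlgEquiv.ext hττ
  have hτ1 : τ ≠ 1 := by
    rintro rfl
    exact htc φ (RingHom.ext fun x ↦ (hconj x).symm)
  by_cases hτc : ∃ g, τ * g ≠ g * τ
  · obtain ⟨σ, hσ, hτσ, hbij⟩ := exists_order_three_bijective
      (by rw [IsGalois.card_aut_eq_finrank, hdeg]) hτ1 hτ2 hτc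
    have h : IsDihedralPair φ σ τ := ⟨hconj, fun x ↦ DFunLike.congr_fun hσ x, hττ,
      fun x ↦ DFunLike.congr_fun hτσ x, hbij⟩
    exact h.exists_infinite_ratio_fixed hτ1 hβ hE (fun x hx ↦ (hEi x hx).1) hEn htr
  · push Not at hτc
    obtain ⟨y, -, hinf⟩ := exists_infinite_fiber_of_mapsTo hE
      (Embeddings.finite_of_norm_le K ℂ 1) (f := fun x ↦ τ x / x) (fun x hx ↦ by
        refine ⟨?_, fun ψ ↦ ?_⟩
        · simp only [div_eq_mul_inv]
          exact ((hEi x hx).1.map (τ : K →+* K).toIntAlgHom).mul (hEi x hx).2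
        · obtain ⟨g, hg⟩ := exists_algEquiv_comp_eq φ ψ
          rw [hg, map_div₀, map_div₀, norm_div,
            show g (τ x) = τ (g x) from (DFunLike.congr_fun (hτc g) x).symm, hconj,
            RCLike.norm_conj]
          exact div_self_le_one _)
    obtain ⟨x₀, hx₀, hy₀⟩ := hinf.nonempty
    refine ⟨τ, hτ1, hτ2, x₀, hx₀, hinf.mono ?_⟩
    rintro x ⟨hx, hy⟩
    have hne : ∀ z ∈ E, z ≠ 0 := by
      rintro z hz rfl
      simpa using hEn 0 hz
    have h0 := hne x₀ hx₀
    have h1 := hne x hx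
    have h2 : τ x₀ ≠ 0 := by simpa using h0
    refine ⟨hx, ?_⟩
    have h3 : τ x / x = τ x₀ / x₀ := hy.trans hy₀.symm
    rw [map_div₀]
    field_simp at h3 ⊢
    linear_combination h3

/-- A proper subspace of a number field lies in the kernel of `x ↦ Tr (β * x)` for some `β ≠ 0`. -/
lemma exists_ne_zero_trace_mul_eq_zero {K : Type*} [Field K] [NumberField K] {W : Submodule ℚ K}
    (hW : W < ⊤) : ∃ β : K, β ≠ 0 ∧ ∀ w ∈ W, Algebra.trace ℚ K (β * w) = 0 := by
  obtain ⟨f, hf, hfW⟩ := Submodule.exists_le_ker_of_lt_top W hW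
  obtain ⟨β, rfl⟩ := ((Algebra.traceForm ℚ K).toDual
    (traceForm_nondegenerate ℚ K)).surjective f
  refine ⟨β, ?_, fun w hw ↦ ?_⟩
  · rintro rfl
    simp at hf
  · simpa [LinearMap.BilinForm.toDual_def, Algebra.traceForm_apply] using hfW hw

/-- Infinitely many elements with bounded denominators and equal nonzero norm contain infinitely
many elements with ratios which are units. -/
lemma exists_infinite_isIntegral_div {K : Type*} [Field K] [NumberField K] {U : Set K}
    (hU : U.Infinite) {D : ℤ} (hD : D ≠ 0) (hDU : ∀ u ∈ U, IsIntegral ℤ ((D : K) * u))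
    {q : ℚ} (hq : q ≠ 0) (hn : ∀ u ∈ U, Algebra.norm ℚ u = q) :
    ∃ u₀ ∈ U, {u ∈ U | IsIntegral ℤ (u / u₀) ∧ IsIntegral ℤ (u / u₀)⁻¹}.Infinite := by
  have hDK : (D : K) ≠ 0 := by exact_mod_cast hD
  have hne : ∀ u ∈ U, u ≠ 0 := by
    rintro u hu rfl
    exact hq (by rw [← hn 0 hu, Algebra.norm_zero])
  have hlift : ∀ u, ∃ a : 𝓞 K, u ∈ U → (a : K) = D * u := fun u ↦ by
    by_cases hu : u ∈ U
    · exact ⟨⟨_, hDU u hu⟩, fun _ ↦ rfl⟩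
    · exact ⟨0, fun h ↦ absurd h hu⟩
  choose a ha using hlift
  have hnorm : ∀ u ∈ U, (Ideal.absNorm (Ideal.span {a u}) : ℚ) =
      |Algebra.norm ℚ (D : K) * q| := by
    intro u hu
    rw [Ideal.absNorm_span_singleton, Nat.cast_natAbs, Int.cast_abs, Algebra.coe_norm_int,
      ha u hu, ← hn u hu, ← map_mul]
  obtain ⟨v, hv⟩ := hU.nonempty
  obtain ⟨I, -, hI⟩ := exists_infinite_fiber_of_mapsTo hU (f := fun u ↦ Ideal.span {a u})
    (Ideal.finite_setOfPred_absNorm_eq (S := 𝓞 K) (Ideal.absNorm (Ideal.span {a v}))) (fun u hu ↦ by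
      have := (hnorm u hu).trans (hnorm v hv).symm
      exact_mod_cast this)
  obtain ⟨u₀, hu₀, hI₀⟩ := hI.nonempty
  have hdiv : ∀ u ∈ U, ∀ w ∈ U, Ideal.span {a u} = Ideal.span {a w} →
      IsIntegral ℤ (u / w) := by
    intro u hu w hw huw
    obtain ⟨c, hc⟩ := Ideal.span_singleton_le_span_singleton.1 huw.le
    have hc' : (D : K) * u = D * w * c := by rw [← ha u hu, ← ha w hw, hc]; rfl
    have hw0 := hne w hw
    have : u / w = c := by
      rw [div_eq_iff hw0]
      exact mul_left_cancel₀ hDK (by rw [hc']; ring)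
    rw [this]
    exact c.isIntegral_coe
  refine ⟨u₀, hu₀, hI.mono ?_⟩
  rintro u ⟨hu, huI⟩
  refine ⟨hu, hdiv u hu u₀ hu₀ (huI.trans hI₀.symm), ?_⟩
  rw [inv_div]
  exact hdiv u₀ hu₀ u hu (hI₀.trans huI.symm)

/-- The fixed field of an involution of a Galois sextic field is cubic. -/
lemma finrank_fixedField_zpowers {K : Type*} [Field K] [NumberField K] [IsGalois ℚ K]
    (hdeg : Module.finrank ℚ K = 6) {ρ : K ≃ₐ[ℚ] K} (hρ1 : ρ ≠ 1) (hρ2 : ρ * ρ = 1) :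
    Module.finrank ℚ (IntermediateField.fixedField (Subgroup.zpowers ρ)) = 3 := by
  have h1 : Module.finrank (IntermediateField.fixedField (Subgroup.zpowers ρ)) K = 2 := by
    rw [IntermediateField.finrank_fixedField_eq_card, Nat.card_zpowers]
    exact orderOf_eq_prime (by rw [sq, hρ2]) hρ1
  have h2 := Module.finrank_mul_finrank ℚ (IntermediateField.fixedField (Subgroup.zpowers ρ)) K
  rw [h1, hdeg] at h2
  omega

lemma mem_fixedField_zpowers {K : Type*} [Field K] [NumberField K] {ρ : K ≃ₐ[ℚ] K} {x : K}
    (hx : ρ x = x) : x ∈ IntermediateField.fixedField (Subgroup.zpowers ρ) := by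
  rintro ⟨g, hg⟩
  have : Subgroup.zpowers ρ ≤ MulAction.stabilizer (K ≃ₐ[ℚ] K) x :=
    (Subgroup.zpowers_le).2 hx
  exact this hg

/-- If a norm-form equation `N_{K/ℚ}(x₁α₁ + ⋯ + x₅α₅) = m` over a totally complex Galois
sextic field `K` (with the `αᵢ` `ℚ`-linearly independent and their ratios generating `K`
over `ℚ`, and `m` a nonzero integer) has infinitely many integer solutions, then there is
a cubic subfield `L ⊆ K` and a solution with associated value `u₀ ≠ 0` such that
infinitely many solutions `x` satisfy `(x₁α₁ + ⋯ + x₅α₅)/u₀ ∈ L`. -/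
theorem infinite_solutions_from_cubic_subfield
    (K : Type*) [Field K] [NumberField K] [IsGalois ℚ K]
    (hdeg : Module.finrank ℚ K = 6)
    (htc : ∀ φ : K →+* ℂ, ¬ ComplexEmbedding.IsReal φ)
    (α : Fin 5 → K) (hli : LinearIndependent ℚ α)
    (hgen : IntermediateField.adjoin ℚ {x : K | ∃ i j, x = α i / α j} = ⊤)
    (m : ℤ) (hm : m ≠ 0)
    (hinf : {x : Fin 5 → ℤ | Algebra.norm ℚ (∑ i, (x i : K) * α i) = (m : ℚ)}.Infinite) :
    ∃ (L : IntermediateField ℚ K) (x₀ : Fin 5 → ℤ),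
      Module.finrank ℚ ↥L = 3 ∧
      Algebra.norm ℚ (∑ i, (x₀ i : K) * α i) = (m : ℚ) ∧
      (∑ i, (x₀ i : K) * α i) ≠ 0 ∧
      {x : Fin 5 → ℤ | Algebra.norm ℚ (∑ i, (x i : K) * α i) = (m : ℚ) ∧
        (∑ i, (x i : K) * α i) / (∑ i, (x₀ i : K) * α i) ∈ L}.Infinite := by
  set u : (Fin 5 → ℤ) → K := fun x ↦ ∑ i, (x i : K) * α i with hu
  have huinj : Function.Injective u := by
    intro x y hxy
    have h0 : ∑ i, ((x i - y i : ℤ) : ℚ) • α i = 0 := by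
      simp only [Algebra.smul_def, Int.cast_sub, map_sub, map_intCast, sub_mul,
        Finset.sum_sub_distrib]
      exact sub_eq_zero.2 hxy
    funext i
    have := Fintype.linearIndependent_iff.1 hli _ h0 i
    exact sub_eq_zero.1 (by exact_mod_cast this)
  have hlt : Submodule.span ℚ (Set.range α) < ⊤ := by
    refine Submodule.lt_top_of_finrank_lt_finrank ?_
    rw [finrank_span_eq_card hli, hdeg, Fintype.card_fin]
    norm_num
  obtain ⟨β, hβ, htr⟩ := exists_ne_zero_trace_mul_eq_zero hlt
  have hutr : ∀ x, Algebra.trace ℚ K (β * u x) = 0 := fun x ↦ htr _ <|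
    Submodule.sum_mem _ fun i _ ↦ by
      rw [← zsmul_eq_mul]
      exact zsmul_mem (Submodule.subset_span (Set.mem_range_self i)) _
  choose d hd0 hd using fun i ↦ exists_int_ne_zero_isIntegral_mul (α i)
  have hDu : ∀ x, IsIntegral ℤ (((∏ i, d i : ℤ) : K) * u x) := by
    intro x
    rw [hu, Finset.mul_sum]
    refine IsIntegral.sum _ fun i _ ↦ ?_
    rw [← Finset.mul_prod_erase _ _ (Finset.mem_univ i), Int.cast_mul,
      show ∀ a b c e : K, a * b * (c * e) = b * c * (a * e) by intros; ring]
    exact ((isIntegral_algebraMap (R := ℤ) (x := _)).mul isIntegral_algebraMap).mul (hd i)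
  have hmq : (m : ℚ) ≠ 0 := by exact_mod_cast hm
  obtain ⟨_, ⟨x₀, hx₀, rfl⟩, hinf'⟩ := exists_infinite_isIntegral_div
    (hinf.image huinj.injOn) (Finset.prod_ne_zero_iff.2 fun i _ ↦ hd0 i)
    (by rintro _ ⟨x, -, rfl⟩; exact hDu x) hmq (by rintro _ ⟨x, hx, rfl⟩; exact hx)
  have hne : ∀ x, Algebra.norm ℚ (u x) = m → u x ≠ 0 := by
    intro x hx h0
    exact hmq (by rw [← hx, h0, Algebra.norm_zero])
  have h0 := hne x₀ hx₀
  obtain ⟨ρ, hρ1, hρ2, _, ⟨_, ⟨⟨x₁, hx₁, rfl⟩, -⟩, rfl⟩, hfix⟩ :=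
    exists_infinite_ratio_fixed_of_trace_eq_zero hdeg htc (mul_ne_zero hβ h0)
      (hinf'.image (f := fun z ↦ z / u x₀) fun _ _ _ _ h ↦ (div_left_inj' h0).1 h)
      (by rintro _ ⟨z, hz, rfl⟩; exact hz.2)
      (by
        rintro _ ⟨_, ⟨⟨x, hx, rfl⟩, -⟩, rfl⟩
        refine mul_right_cancel₀ hmq ?_
        rw [one_mul, ← hx₀, ← map_mul, div_mul_cancel₀ _ h0, hx₀]
        exact hx)
      (by
        rintro _ ⟨_, ⟨⟨x, hx, rfl⟩, -⟩, rfl⟩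
        rw [mul_assoc, mul_div_cancel₀ _ h0]
        exact hutr x)
  refine ⟨IntermediateField.fixedField (Subgroup.zpowers ρ), x₁,
    finrank_fixedField_zpowers hdeg hρ1 hρ2, hx₁, hne x₁ hx₁, ?_⟩
  refine Set.Infinite.of_image (fun x ↦ u x / u x₀) (hfix.mono ?_)
  rintro _ ⟨⟨_, ⟨⟨x, hx, rfl⟩, -⟩, rfl⟩, hρx⟩
  refine ⟨x, ⟨hx, mem_fixedField_zpowers ?_⟩, rfl⟩
  rwa [div_div_div_cancel_right₀ h0] at hρx
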